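/- arXiv:1706.08804 — 4 statements merged into one kernel-verified Lean document; each statement's English description precedes it below -/
import Mathlib

section
/- Let M = (M_p) be a logarithmically convex sequence of positive reals with M_0 = 1, whose quotients m_p := M_{p+1}/M_p tend to infinity, and which admits a nonzero proximate order, and let 0 < γ < ω(M). Suppose f is a bounded holomorphic function on the sector S_γ that admits a continuous extension to the boundary ∂S_γ and is M-flat in the direction d = πγ/2. Then for every 0 < δ < πγ there exist constants k1(δ), k2(δ) > 0 such that |f(z)| ≤ k1·e^{−M(1/(k2·|z|))} for every z ∈ S_γ ∪ ∂S_γ with arg(z) ∈ [−πγ/2 + δ, πγ/2]. -/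
open Filter Topology Set
open scoped Real

noncomputable section

/-!
We model functions on (subsets of) the Riemann surface of the logarithm through the
logarithmic chart: a point `z = e^w` of the Riemann surface (with modulus `|z| = exp (Re w)`
and argument `arg z = Im w`) corresponds to the point `w : ℂ`.  A holomorphic function `f`
on a sector corresponds to the holomorphic function `w ↦ f (e^w)` on the corresponding
horizontal strip, and `z → 0` corresponds to `Re w → -∞`.
-/

/-- `M` is a sequence of positive reals with `M 0 = 1`, logarithmically convex,
whose sequence of quotients `m p = M (p+1) / M p` tends to infinity. -/
def GoodSeq (M : ℕ → ℝ) : Prop :=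
  M 0 = 1 ∧ (∀ p, 0 < M p) ∧ (∀ p : ℕ, (M (p + 1)) ^ 2 ≤ M p * M (p + 2)) ∧
    Tendsto (fun p : ℕ => M (p + 1) / M p) atTop atTop

/-- The associated function `M(t) = sup_p log (t^p / M_p)`. -/
def assocM (M : ℕ → ℝ) (t : ℝ) : ℝ := ⨆ p : ℕ, Real.log (t ^ p / M p)

/-- The index `ω(M) = liminf_p log (m_p) / log p`. -/
def omegaM (M : ℕ → ℝ) : ℝ :=
  Filter.liminf (fun p : ℕ => Real.log (M (p + 1) / M p) / Real.log (p : ℝ)) atTop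

/-- `ρ` is a proximate order on `(c, ∞)` with limit `ℓ` at infinity:  continuous and
piecewise continuously differentiable (differentiable except possibly on a set `E` of points
that is finite below any bound, at each of which it has distinct finite lateral derivatives),
nonnegative, with `ρ(r) → ℓ` and `r ρ'(r) log r → 0` as `r → ∞`. -/
def IsProximateOrder (c : ℝ) (ρ : ℝ → ℝ) (ℓ : ℝ) : Prop :=
  ContinuousOn ρ (Ioi c) ∧ (∀ r ∈ Ioi c, 0 ≤ ρ r) ∧ Tendsto ρ atTop (𝓝 ℓ) ∧
    ∃ (E : Set ℝ) (ρ' : ℝ → ℝ),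
      (∀ R : ℝ, (E ∩ Iic R).Finite) ∧
      (∀ r ∈ Ioi c \ E, HasDerivAt ρ (ρ' r) r) ∧
      ContinuousOn ρ' (Ioi c \ E) ∧
      (∀ r ∈ E ∩ Ioi c, ∃ dl dr : ℝ, dl ≠ dr ∧
        HasDerivWithinAt ρ dl (Iio r) r ∧ HasDerivWithinAt ρ dr (Ioi r) r) ∧
      Tendsto (fun r => r * ρ' r * Real.log r) (atTop ⊓ 𝓟 (Ioi c \ E)) (𝓝 0)

/-- The sequence `M` admits a nonzero proximate order: there are a nonzero proximate order
`ρ(t)` and constants `A ≤ B` with `A ≤ log t · (ρ(t) − d_M(t)) ≤ B` for `t` large,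
where `d_M(t) = log M(t) / log t`. -/
def AdmitsNonzeroProximateOrder (M : ℕ → ℝ) : Prop :=
  ∃ (c ℓ : ℝ) (ρ : ℝ → ℝ), 0 < ℓ ∧ IsProximateOrder c ρ ℓ ∧
    ∃ A B : ℝ, ∀ᶠ t in atTop,
      A ≤ Real.log t * (ρ t - Real.log (assocM M t) / Real.log t) ∧
      Real.log t * (ρ t - Real.log (assocM M t) / Real.log t) ≤ B

/-- The unbounded open sector `S(d, γ)` (bisecting direction `d`, opening `γπ`),
in the logarithmic chart. -/
def logSector (d γ : ℝ) : Set ℂ := {w : ℂ | |w.im - d| < γ * π / 2}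

/-- The bounded open sector `S(d, γ, R)` (radius `R`), in the logarithmic chart. -/
def logSectorB (d γ R : ℝ) : Set ℂ :=
  {w : ℂ | |w.im - d| < γ * π / 2 ∧ w.re < Real.log R}

/-- The closure of `S(d, γ, R)` in the Riemann surface of the logarithm
(the vertex is not present), in the logarithmic chart. -/
def logSectorC (d γ R : ℝ) : Set ℂ :=
  {w : ℂ | |w.im - d| ≤ γ * π / 2 ∧ w.re ≤ Real.log R}

/-- `G` is a sectorial region `G(d, γ)`: an open connected subset of `S(d, γ)` that,
for every `0 < β < γ`, contains a bounded sector `S(d, β, ρ)`. -/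
def SectorialRegion (d γ : ℝ) (G : Set ℂ) : Prop :=
  IsOpen G ∧ IsConnected G ∧ G ⊆ logSector d γ ∧
    ∀ β : ℝ, 0 < β → β < γ → ∃ ρ : ℝ, 0 < ρ ∧ logSectorB d β ρ ⊆ G

/-- The bounded sector `S(d, β, r)` is a proper subsector of `G` (written `T ≪ G`):
its closure in the Riemann surface of the logarithm is contained in `G`. -/
def ProperSubsector (G : Set ℂ) (d β r : ℝ) : Prop :=
  0 < β ∧ 0 < r ∧ logSectorC d β r ⊆ G

/-- `f` (defined on `D`) is `M`-flat in the direction `θ`: there are `r, C, A > 0` such that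
the segment `(0, r e^{iθ}]` lies in `D` and `|f(z)| ≤ C A^p M_p |z|^p` on it, for all `p`. -/
def MFlatDir (M : ℕ → ℝ) (f : ℂ → ℂ) (D : Set ℂ) (θ : ℝ) : Prop :=
  ∃ r C A : ℝ, 0 < r ∧ 0 < C ∧ 0 < A ∧
    (∀ x : ℝ, x ≤ Real.log r → (⟨x, θ⟩ : ℂ) ∈ D) ∧
    ∀ x : ℝ, x ≤ Real.log r → ∀ p : ℕ,
      ‖f ⟨x, θ⟩‖ ≤ C * A ^ p * M p * Real.exp x ^ p

/-- `f` (bounded, defined on `D`) is Beurling `M`-flat in the direction `θ`. -/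
def BeurlingFlatDir (M : ℕ → ℝ) (f : ℂ → ℂ) (D : Set ℂ) (θ : ℝ) : Prop :=
  ∀ c2 : ℝ, 0 < c2 → ∃ c1 : ℝ, 0 < c1 ∧
    ∀ w ∈ D, w.im = θ →
      ‖f w‖ ≤ c1 * Real.exp (-assocM M (1 / (c2 * Real.exp w.re)))

/-- `f` admits `Σ a_n z^n` as its `M`-asymptotic expansion in the region `G`:  on every
proper subsector `T ≪ G` there are `C, A > 0` with
`|f(z) − Σ_{n<p} a_n z^n| ≤ C A^p M_p |z|^p` for all `z ∈ T`, `p ∈ ℕ`.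
(In the logarithmic chart, `z = e^w`.) -/
def AsympExpandsOn (M : ℕ → ℝ) (f : ℂ → ℂ) (a : ℕ → ℂ) (G : Set ℂ) : Prop :=
  ∀ d β r : ℝ, ProperSubsector G d β r → ∃ C A : ℝ, 0 < C ∧ 0 < A ∧
    ∀ w ∈ logSectorB d β r, ∀ p : ℕ,
      ‖f w - ∑ n ∈ Finset.range p, a n * Complex.exp w ^ n‖
        ≤ C * A ^ p * M p * Real.exp w.re ^ p

/-- `f` admits `Σ a_n z^n` as its `M`-asymptotic expansion in the direction `θ`: there are
`r, C, A > 0` such that the segment `(0, r e^{iθ}]` lies in `G` and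
`|f(z) − Σ_{n<p} a_n z^n| ≤ C A^p M_p |z|^p` on it, for all `p`. -/
def AsympExpandsDir (M : ℕ → ℝ) (f : ℂ → ℂ) (a : ℕ → ℂ) (G : Set ℂ) (θ : ℝ) : Prop :=
  ∃ r C A : ℝ, 0 < r ∧ 0 < C ∧ 0 < A ∧
    (∀ x : ℝ, x ≤ Real.log r → (⟨x, θ⟩ : ℂ) ∈ G) ∧
    ∀ x : ℝ, x ≤ Real.log r → ∀ p : ℕ,
      ‖f (⟨x, θ⟩ : ℂ) - ∑ n ∈ Finset.range p, a n * Complex.exp (⟨x, θ⟩ : ℂ) ^ n‖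
        ≤ C * A ^ p * M p * Real.exp x ^ p

/-- The derivative with respect to the base variable `z = e^w`, in the logarithmic chart:
`(d/dz) f = e^{-w} (d/dw) f`. -/
def zderiv (f : ℂ → ℂ) : ℂ → ℂ := fun w => Complex.exp (-w) * deriv f w

/-- The filter of approach to the vertex (`z → 0`, i.e. `Re w → -∞`) within `D`. -/
def vertexFilter (D : Set ℂ) : Filter ℂ := Filter.comap Complex.re atBot ⊓ 𝓟 D

/-- The class `Ã^u_M(S)` contains no nontrivial function whose uniform `M`-asymptotic
expansion on `S` is the null power series. -/
def UniformQuasianalytic (M : ℕ → ℝ) (S : Set ℂ) : Prop :=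
  ∀ f : ℂ → ℂ, DifferentiableOn ℂ f S →
    (∃ C A : ℝ, 0 < C ∧ 0 < A ∧
      ∀ w ∈ S, ∀ p : ℕ, ‖f w‖ ≤ C * A ^ p * M p * Real.exp w.re ^ p) →
    ∀ w ∈ S, f w = 0

/-- The terms of the associated function are bounded above. -/
theorem assoc_bdd (M : ℕ → ℝ) (hM : GoodSeq M) (t : ℝ) (ht : 0 < t) :
    BddAbove (range fun p : ℕ => Real.log (t ^ p / M p)) := by
  obtain ⟨_, hpos, _, hlim⟩ := hM
  obtain ⟨N, hN⟩ := eventually_atTop.1 (hlim.eventually_ge_atTop t)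
  have key : ∀ p, N ≤ p → Real.log (t ^ p / M p) ≤ Real.log (t ^ N / M N) := by
    intro p hp
    induction p, hp using Nat.le_induction with
    | base => exact le_rfl
    | succ p hp ih =>
      refine le_trans ?_ ih
      apply Real.log_le_log (div_pos (pow_pos ht _) (hpos _))
      rw [div_le_div_iff₀ (hpos _) (hpos _)]
      have h1 := (le_div_iff₀ (hpos p)).1 (hN p hp)
      have h2 : 0 < t ^ p := pow_pos ht p
      rw [pow_succ]
      nlinarith
  refine ⟨∑ p ∈ Finset.range (N + 1), |Real.log (t ^ p / M p)|, ?_⟩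
  have small : ∀ p, p ≤ N → Real.log (t ^ p / M p) ≤
      ∑ p ∈ Finset.range (N + 1), |Real.log (t ^ p / M p)| := by
    intro p hp
    refine (le_abs_self _).trans ?_
    exact Finset.single_le_sum (f := fun p => |Real.log (t ^ p / M p)|)
      (fun i _ => abs_nonneg _) (Finset.mem_range.2 (by omega))
  rintro _ ⟨p, rfl⟩
  rcases le_total p N with h | h
  · exact small p h
  · exact (key p h).trans (small N le_rfl)

theorem assoc_nonneg (M : ℕ → ℝ) (hM : GoodSeq M) (t : ℝ) (ht : 0 < t) : 0 ≤ assocM M t := by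
  have := le_ciSup (assoc_bdd M hM t ht) 0
  have h0 : Real.log (t ^ 0 / M 0) = 0 := by simp [hM.1]
  exact h0.symm.le.trans this

theorem assoc_mono (M : ℕ → ℝ) (hM : GoodSeq M) (s t : ℝ) (hs : 0 < s) (hst : s ≤ t) :
    assocM M s ≤ assocM M t := by
  refine ciSup_mono (assoc_bdd M hM t (hs.trans_le hst)) fun p => ?_
  have := hM.2.1 p
  apply Real.log_le_log (by positivity)
  gcongr

/-- Monotonicity from a nonnegative derivative off a locally finite set. -/
theorem le_of_deriv_off_finite (φ φ' : ℝ → ℝ) (E : Set ℝ) (hE : ∀ R : ℝ, (E ∩ Iic R).Finite) :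
    ∀ n : ℕ, ∀ a b : ℝ, a ≤ b → (E ∩ Ioo a b).ncard ≤ n → ContinuousOn φ (Icc a b) →
      (∀ x ∈ Ioo a b \ E, HasDerivAt φ (φ' x) x) → (∀ x ∈ Ioo a b \ E, 0 ≤ φ' x) →
      φ a ≤ φ b := by
  have fin : ∀ a b : ℝ, (E ∩ Ioo a b).Finite := fun a b =>
    (hE b).subset fun x hx => ⟨hx.1, hx.2.2.le⟩
  have base : ∀ a b : ℝ, a ≤ b → (E ∩ Ioo a b) = ∅ → ContinuousOn φ (Icc a b) →
      (∀ x ∈ Ioo a b \ E, HasDerivAt φ (φ' x) x) → (∀ x ∈ Ioo a b \ E, 0 ≤ φ' x) →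
      φ a ≤ φ b := by
    intro a b hab he hc hd hn
    have hmem : ∀ x ∈ Ioo a b, x ∈ Ioo a b \ E := fun x hx =>
      ⟨hx, fun hxE => by
        have : x ∈ E ∩ Ioo a b := ⟨hxE, hx⟩
        simp [he] at this⟩
    have := monotoneOn_of_deriv_nonneg (convex_Icc a b) hc
      (by rw [interior_Icc]
          exact fun x hx => (hd x (hmem x hx)).differentiableAt.differentiableWithinAt)
      (by rw [interior_Icc]
          intro x hx
          rw [(hd x (hmem x hx)).deriv]
          exact hn x (hmem x hx))
    exact this (left_mem_Icc.2 hab) (right_mem_Icc.2 hab) hab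
  intro n
  induction n with
  | zero =>
    intro a b hab hcard hc hd hn
    exact base a b hab ((Set.ncard_eq_zero (fin a b)).1 (by omega)) hc hd hn
  | succ n ih =>
    intro a b hab hcard hc hd hn
    by_cases he : E ∩ Ioo a b = ∅
    · exact base a b hab he hc hd hn
    obtain ⟨e, heE, hea, heb⟩ := Set.nonempty_iff_ne_empty.2 he
    have sub1 : Ioo a e ⊆ Ioo a b := Ioo_subset_Ioo_right heb.le
    have sub2 : Ioo e b ⊆ Ioo a b := Ioo_subset_Ioo_left hea.le
    have c1 : (E ∩ Ioo a e).ncard < (E ∩ Ioo a b).ncard := by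
      apply Set.ncard_lt_ncard _ (fin a b)
      refine ⟨inter_subset_inter_right _ sub1, fun h => ?_⟩
      exact lt_irrefl e (h ⟨heE, hea, heb⟩).2.2
    have c2 : (E ∩ Ioo e b).ncard < (E ∩ Ioo a b).ncard := by
      apply Set.ncard_lt_ncard _ (fin a b)
      refine ⟨inter_subset_inter_right _ sub2, fun h => ?_⟩
      exact lt_irrefl e (h ⟨heE, hea, heb⟩).2.1
    exact (ih a e hea.le (by omega) (hc.mono (Icc_subset_Icc_right heb.le))
        (fun x hx => hd x ⟨sub1 hx.1, hx.2⟩) (fun x hx => hn x ⟨sub1 hx.1, hx.2⟩)).trans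
      (ih e b heb.le (by omega) (hc.mono (Icc_subset_Icc_left hea.le))
        (fun x hx => hd x ⟨sub2 hx.1, hx.2⟩) (fun x hx => hn x ⟨sub2 hx.1, hx.2⟩))

/-- Growth of `r ^ ρ(r)` for a nonzero proximate order. -/
theorem prox_growth (c ℓ : ℝ) (ρ : ℝ → ℝ) (hℓ : 0 < ℓ) (h : IsProximateOrder c ρ ℓ) :
    ∃ T : ℝ, 0 < T ∧ ∀ s t : ℝ, T ≤ s → s ≤ t →
      ρ s * Real.log s - ℓ / 2 * Real.log s ≤ ρ t * Real.log t - ℓ / 2 * Real.log t := by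
  obtain ⟨hc, _, hlim, E, ρ', hE, hd, _, _, h0⟩ := h
  have e1 : ∀ᶠ r in atTop, 3 * ℓ / 4 < ρ r := hlim.eventually (lt_mem_nhds (by linarith))
  have e2 : ∀ᶠ r in atTop ⊓ 𝓟 (Ioi c \ E), -(ℓ / 4) < r * ρ' r * Real.log r :=
    h0.eventually (lt_mem_nhds (by linarith))
  rw [eventually_inf_principal] at e2
  obtain ⟨T, hT⟩ := eventually_atTop.1 (e1.and (e2.and ((eventually_gt_atTop 0).and
    (eventually_gt_atTop c))))
  have hT0 : 0 < T := (hT T le_rfl).2.2.1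
  refine ⟨T, hT0, fun s t hs hst => ?_⟩
  have pos : ∀ x, s ≤ x → 0 < x := fun x hx => by linarith
  refine le_of_deriv_off_finite (fun r => ρ r * Real.log r - ℓ / 2 * Real.log r)
    (fun r => (ρ' r * Real.log r + ρ r * r⁻¹) - ℓ / 2 * r⁻¹) E hE _ s t hst le_rfl ?_ ?_ ?_
  · have hl : ContinuousOn Real.log (Icc s t) :=
      Real.continuousOn_log.mono fun x hx => (pos x hx.1).ne'
    have hρ : ContinuousOn ρ (Icc s t) :=
      hc.mono fun x hx => (hT x (hs.trans hx.1)).2.2.2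
    exact (hρ.mul hl).sub (hl.const_mul (ℓ / 2))
  · rintro x ⟨⟨hx1, hx2⟩, hxE⟩
    have hl := Real.hasDerivAt_log (pos x hx1.le).ne'
    exact ((hd x ⟨(hT x (hs.trans hx1.le)).2.2.2, hxE⟩).mul hl).sub (hl.const_mul (ℓ / 2))
  · rintro x ⟨⟨hx1, hx2⟩, hxE⟩
    obtain ⟨a1, a2, a3, a4⟩ := hT x (hs.trans hx1.le)
    have a5 := a2 ⟨a4, hxE⟩
    have : (ρ' x * Real.log x + ρ x * x⁻¹) - ℓ / 2 * x⁻¹ =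
        (x * ρ' x * Real.log x + ρ x - ℓ / 2) * x⁻¹ := by
      field_simp
    simp only [this]
    exact mul_nonneg (by linarith) (by positivity)

/-- Absorbing a multiplicative constant into a dilation. -/
theorem assoc_dilate (M : ℕ → ℝ) (hM : GoodSeq M) (hPO : AdmitsNonzeroProximateOrder M)
    (c : ℝ) (hc : 0 < c) :
    ∃ k T : ℝ, 0 < k ∧ 0 < T ∧ ∀ t, T ≤ t → assocM M (t / k) ≤ c * assocM M t := by
  obtain ⟨c0, ℓ, ρ, hℓ, hρ, A, B, hAB⟩ := hPO
  obtain ⟨T1, hT1, hgr⟩ := prox_growth c0 ℓ ρ hℓ hρ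
  obtain ⟨T2, hT2⟩ := eventually_atTop.1 hAB
  set q : ℝ := max 0 ((B - A - Real.log c) / (ℓ / 2)) with hq
  have hq0 : 0 ≤ q := le_max_left _ _
  have hq1 : B - A - Real.log c ≤ ℓ / 2 * q := by
    have := le_max_right 0 ((B - A - Real.log c) / (ℓ / 2))
    rw [← hq, div_le_iff₀ (by positivity)] at this
    linarith
  have hk1 : 1 ≤ Real.exp q := Real.one_le_exp hq0
  have hk0 := Real.exp_pos q
  refine ⟨Real.exp q, Real.exp q * (max (max T1 T2) 2), hk0, by positivity, fun t ht => ?_⟩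
  have hs : max (max T1 T2) 2 ≤ t / Real.exp q := by
    rw [le_div_iff₀ hk0]; linarith
  set s := t / Real.exp q with hsdef
  have hs1 : T1 ≤ s := (le_max_left _ _).trans ((le_max_left _ _).trans hs)
  have hs2 : T2 ≤ s := (le_max_right _ _).trans ((le_max_left _ _).trans hs)
  have hs3 : 2 ≤ s := (le_max_right _ _).trans hs
  have hts : t = Real.exp q * s := by rw [hsdef]; field_simp
  have hst : s ≤ t := by rw [hts]; nlinarith
  have hs0 : 0 < s := by linarith
  have hm := assoc_mono M hM s t hs0 hst
  have hn := assoc_nonneg M hM t (by linarith)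
  rcases le_or_gt (assocM M s) 0 with h0 | h0
  · exact h0.trans (by positivity)
  have ht0 : 0 < assocM M t := h0.trans_le hm
  have hls : 0 < Real.log s := Real.log_pos (by linarith)
  have hlt : 0 < Real.log t := Real.log_pos (by linarith)
  have hlog : Real.log t = q + Real.log s := by
    rw [hts, Real.log_mul hk0.ne' hs0.ne', Real.log_exp]
  have f1 := (hT2 s hs2).1
  have f2 := (hT2 t (hs2.trans hst)).2
  have f3 := hgr s t hs1 hst
  rw [mul_sub, mul_div_cancel₀ _ hls.ne'] at f1
  rw [mul_sub, mul_div_cancel₀ _ hlt.ne'] at f2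
  rw [← Real.log_le_log_iff h0 (by positivity), Real.log_mul hc.ne' ht0.ne']
  have f4 : ℓ / 2 * Real.log t = ℓ / 2 * q + ℓ / 2 * Real.log s := by rw [hlog]; ring
  linarith

/-- A local two constants theorem on a rectangle. -/
theorem two_constants (a : ℝ) (ha : 0 < a) (f : ℂ → ℂ) (x y K L : ℝ) (hL : 0 ≤ L)
    (hd : DifferentiableOn ℂ f {w : ℂ | |w.im| < a})
    (hc : ContinuousOn f {w : ℂ | |w.im| ≤ a})
    (hK : ∀ w : ℂ, |w.im| ≤ a → ‖f w‖ ≤ K)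
    (htop : ∀ s : ℝ, s ≤ x + π / 2 → ‖f ⟨s, a⟩‖ ≤ K * Real.exp (-L))
    (hy1 : -a ≤ y) (hy2 : y ≤ a) :
    ‖f ⟨x, y⟩‖ ≤ K * Real.exp (-(Real.sinh (y + a) / Real.sinh (2 * a) * L)) := by
  have hpi := Real.pi_pos
  have hS : 0 < Real.sinh (2 * a) := Real.sinh_pos_iff.2 (by linarith)
  have hK0 : 0 ≤ K := (norm_nonneg _).trans (hK 0 (by simpa using ha.le))
  set U : Set ℂ := Ioo (x - π / 2) (x + π / 2) ×ℂ Ioo (-a) a with hU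
  have hcl : closure U = Icc (x - π / 2) (x + π / 2) ×ℂ Icc (-a) a := by
    rw [hU, Complex.closure_reProdIm, closure_Ioo (by linarith), closure_Ioo (by linarith)]
  have hopen : IsOpen U := isOpen_Ioo.reProdIm isOpen_Ioo
  set G : ℂ → ℂ := fun w =>
    (-Complex.I) * Complex.sin (w - x + a * Complex.I) * ((L / Real.sinh (2 * a) : ℝ) : ℂ) with hG
  have hGre : ∀ w : ℂ, (G w).re =
      Real.cos (w.re - x) * (Real.sinh (w.im + a) / Real.sinh (2 * a) * L) := by
    intro w
    have e : w - x + a * Complex.I = ((w.re - x : ℝ) : ℂ) + ((w.im + a : ℝ) : ℂ) * Complex.I := by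
      apply Complex.ext <;> simp
    simp only [hG]
    rw [e, Complex.sin_add_mul_I, ← Complex.ofReal_sin, ← Complex.ofReal_cos,
      ← Complex.ofReal_sinh, ← Complex.ofReal_cosh, Complex.re_mul_ofReal]
    generalize Real.sin (w.re - x) = p1
    generalize Real.cos (w.re - x) = p2
    generalize Real.sinh (w.im + a) = p3
    generalize Real.cosh (w.im + a) = p4
    simp
    ring
  have hGd : Differentiable ℂ G := by
    simp only [hG]
    fun_prop
  set F : ℂ → ℂ := fun w => f w * Complex.exp (G w) with hF
  have hFn : ∀ w, ‖F w‖ = ‖f w‖ * Real.exp (G w).re := by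
    intro w; simp [hF, Complex.norm_exp]
  have hexp : Differentiable ℂ fun w => Complex.exp (G w) := hGd.cexp
  have hFd : DiffContOnCl ℂ F U := by
    constructor
    · refine (hd.mono fun w hw => ?_).mul hexp.differentiableOn
      exact abs_lt.2 hw.2
    · rw [hcl]
      refine (hc.mono fun w hw => ?_).mul hexp.continuous.continuousOn
      exact abs_le.2 hw.2
  have hbdd : Bornology.IsBounded U :=
    (Metric.isBounded_Ioo _ _).reProdIm (Metric.isBounded_Ioo _ _)
  have hfr : ∀ w ∈ frontier U, ‖F w‖ ≤ K := by
    intro w hw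
    rw [frontier, hcl, hopen.interior_eq] at hw
    obtain ⟨⟨⟨h1, h2⟩, ⟨h3, h4⟩⟩, hn⟩ := hw
    rw [hFn, hGre]
    have hb := hK w (abs_le.2 ⟨h3, h4⟩)
    by_cases hzero : Real.cos (w.re - x) * (Real.sinh (w.im + a) / Real.sinh (2 * a) * L) = 0
    · rw [hzero]; simpa using hb
    have c1 : w.re ≠ x - π / 2 := by
      intro h; apply hzero; rw [h]; simp
    have c2 : w.re ≠ x + π / 2 := by
      intro h; apply hzero; rw [h]; simp
    have c3 : w.im ≠ -a := by
      intro h; apply hzero; rw [h]; simp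
    have c4 : w.im = a := by
      by_contra h
      exact hn ⟨⟨lt_of_le_of_ne h1 c1.symm, lt_of_le_of_ne h2 c2⟩,
        ⟨lt_of_le_of_ne h3 c3.symm, lt_of_le_of_ne h4 h⟩⟩
    have hw' : w = ⟨w.re, a⟩ := by rw [← c4]
    have ht := htop w.re h2
    rw [← hw'] at ht
    rw [c4, ← two_mul, div_self hS.ne', one_mul]
    calc ‖f w‖ * Real.exp (Real.cos (w.re - x) * L)
        ≤ (K * Real.exp (-L)) * Real.exp L := by
          gcongr
          exact mul_le_of_le_one_left hL (Real.cos_le_one _)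
      _ = K := by rw [mul_assoc, ← Real.exp_add]; simp
  have hmem : (⟨x, y⟩ : ℂ) ∈ closure U := by
    rw [hcl]
    exact ⟨⟨by simp; linarith, by simp; linarith⟩, ⟨hy1, hy2⟩⟩
  have := Complex.norm_le_of_forall_mem_frontier_norm_le hbdd hFd hfr hmem
  rw [hFn, hGre] at this
  simp only [sub_self, Real.cos_zero, one_mul] at this
  rw [Real.exp_neg, ← div_eq_mul_inv, le_div_iff₀ (Real.exp_pos _)]
  exact this

/-- Lemma 3.2 of the paper: a Phragmén–Lindelöf-type extension of
`M`-flatness from the boundary direction `πγ/2` to the directions in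
`[−πγ/2 + δ, πγ/2]`, for `0 < γ < ω(M)`.  Here `f` is bounded and holomorphic on `S_γ`,
`g` is its continuous extension to `S_γ ∪ ∂S_γ`, and `g` is `M`-flat in direction `πγ/2`. -/
theorem mflat_extension_small_opening
    (M : ℕ → ℝ) (hM : GoodSeq M) (hPO : AdmitsNonzeroProximateOrder M)
    (γ : ℝ) (hγ0 : 0 < γ) (hγω : γ < omegaM M) (f g : ℂ → ℂ)
    (hf : DifferentiableOn ℂ f (logSector 0 γ))
    (hbd : ∃ K : ℝ, ∀ w ∈ logSector 0 γ, ‖f w‖ ≤ K)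
    (hg : ContinuousOn g {w : ℂ | |w.im| ≤ γ * π / 2})
    (hfg : ∀ w ∈ logSector 0 γ, g w = f w)
    (hflat : MFlatDir M g {w : ℂ | |w.im| ≤ γ * π / 2} (γ * π / 2)) :
    ∀ δ : ℝ, 0 < δ → δ < π * γ →
      ∃ k1 k2 : ℝ, 0 < k1 ∧ 0 < k2 ∧
        ∀ w : ℂ, -(γ * π / 2) + δ ≤ w.im → w.im ≤ γ * π / 2 →
          ‖g w‖ ≤ k1 * Real.exp (-assocM M (1 / (k2 * Real.exp w.re))) := by
  intro δ hδ _
  have hpi := Real.pi_pos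
  set a : ℝ := γ * π / 2 with ha
  have ha0 : 0 < a := by positivity
  have hsec : logSector 0 γ = {w : ℂ | |w.im| < a} := by simp [logSector, ha]
  rw [hsec] at hf hbd hfg
  obtain ⟨K0, hK0⟩ := hbd
  obtain ⟨r, C, A, hr, hC, hA, _, hfl⟩ := hflat
  have hcl : {w : ℂ | |w.im| ≤ a} ⊆ closure {w : ℂ | |w.im| < a} := by
    have e1 : {w : ℂ | |w.im| ≤ a} = univ ×ℂ Icc (-a) a := by
      ext w; simp [Complex.mem_reProdIm, abs_le]
    have e2 : {w : ℂ | |w.im| < a} = univ ×ℂ Ioo (-a) a := by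
      ext w; simp [Complex.mem_reProdIm, abs_lt]
    rw [e1, e2, Complex.closure_reProdIm, closure_Ioo (by linarith), closure_univ]
  have hgK0 : ∀ w : ℂ, |w.im| ≤ a → ‖g w‖ ≤ K0 := by
    intro w hw
    have hcw : ContinuousWithinAt g {w : ℂ | |w.im| < a} w :=
      (hg w hw).mono fun z (hz : |z.im| < a) => hz.le
    have := mem_closure_iff_nhdsWithin_neBot.1 (hcl hw)
    refine le_of_tendsto hcw.norm ?_
    filter_upwards [self_mem_nhdsWithin] with z hz
    rw [hfg z hz]
    exact hK0 z hz
  have hgd : DifferentiableOn ℂ g {w : ℂ | |w.im| < a} := hf.congr hfg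
  set K : ℝ := max K0 C with hK
  have hKpos : 0 < K := hC.trans_le (le_max_right _ _)
  have hgK : ∀ w : ℂ, |w.im| ≤ a → ‖g w‖ ≤ K := fun w hw => (hgK0 w hw).trans (le_max_left _ _)
  -- flatness in terms of the associated function
  have hflat' : ∀ s : ℝ, s ≤ Real.log r →
      ‖g ⟨s, a⟩‖ ≤ K * Real.exp (-assocM M (1 / (A * Real.exp s))) := by
    intro s hs
    refine le_trans ?_ (mul_le_mul_of_nonneg_right (le_max_right K0 C) (Real.exp_pos _).le)
    rcases (norm_nonneg (g ⟨s, a⟩)).eq_or_lt with h0 | h0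
    · rw [← h0]; positivity
    have : assocM M (1 / (A * Real.exp s)) ≤ Real.log (C / ‖g ⟨s, a⟩‖) := by
      refine ciSup_le fun p => ?_
      have hMp := hM.2.1 p
      have hes := Real.exp_pos s
      apply Real.log_le_log (by positivity)
      have := hfl s hs p
      rw [div_le_div_iff₀ hMp h0, one_div, inv_pow, inv_mul_le_iff₀ (by positivity)]
      rw [mul_pow]
      linarith
    have h2 := Real.exp_le_exp.2 this
    rw [Real.exp_log (by positivity), le_div_iff₀ h0] at h2
    rw [Real.exp_neg, ← div_eq_mul_inv, le_div_iff₀ (Real.exp_pos _)]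
    linarith
  have hS : 0 < Real.sinh (2 * a) := Real.sinh_pos_iff.2 (by linarith)
  have hSd : 0 < Real.sinh δ := Real.sinh_pos_iff.2 hδ
  obtain ⟨k, T, hk, hT, hkT⟩ := assoc_dilate M hM hPO (Real.sinh δ / Real.sinh (2 * a))
    (by positivity)
  set X : ℝ := min (Real.log r - π / 2) (-(π / 2) - Real.log (A * T)) with hX
  set k2 : ℝ := k * A * Real.exp (π / 2) with hk2
  have hk20 : 0 < k2 := by positivity
  have hnn : 0 ≤ assocM M (1 / (k2 * Real.exp X)) := assoc_nonneg M hM _ (by positivity)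
  refine ⟨K * Real.exp (assocM M (1 / (k2 * Real.exp X))), k2, by positivity, hk20, ?_⟩
  intro w hw1 hw2
  have hwa : |w.im| ≤ a := abs_le.2 ⟨by linarith, hw2⟩
  rcases le_or_gt w.re X with hx | hx
  · have hx1 : w.re + π / 2 ≤ Real.log r := by linarith [hx.trans (min_le_left _ _)]
    have hx2 : w.re + π / 2 ≤ -Real.log (A * T) := by linarith [hx.trans (min_le_right _ _)]
    set t : ℝ := 1 / (A * Real.exp (w.re + π / 2)) with ht
    have htT : T ≤ t := by
      have := Real.exp_le_exp.2 hx2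
      rw [Real.exp_neg, Real.exp_log (by positivity)] at this
      rw [ht, le_div_iff₀ (by positivity)]
      calc T * (A * Real.exp (w.re + π / 2)) ≤ T * (A * (A * T)⁻¹) := by gcongr
        _ = 1 := by field_simp
    have htk : t / k = 1 / (k2 * Real.exp w.re) := by
      rw [ht, hk2, Real.exp_add]; field_simp
    have ht0 : 0 < t := hT.trans_le htT
    have hL := assoc_nonneg M hM t ht0
    have two := two_constants a ha0 g w.re w.im K (assocM M t) hL hgd hg hgK
      (fun s hs => (hflat' s (hs.trans hx1)).trans (by
        gcongr
        apply assoc_mono M hM _ _ ht0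
        rw [ht]
        gcongr)) (by linarith) hw2
    have hd := hkT t htT
    rw [htk] at hd
    have hsd : Real.sinh δ / Real.sinh (2 * a) * assocM M t ≤
        Real.sinh (w.im + a) / Real.sinh (2 * a) * assocM M t := by
      gcongr
      exact Real.sinh_le_sinh.2 (by linarith)
    calc ‖g w‖ ≤ K * Real.exp (-(Real.sinh (w.im + a) / Real.sinh (2 * a) * assocM M t)) := two
      _ ≤ K * Real.exp (-assocM M (1 / (k2 * Real.exp w.re))) := by
        gcongr
        exact hd.trans hsd
      _ ≤ _ := by
        gcongr
        exact le_mul_of_one_le_right hKpos.le (Real.one_le_exp hnn)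
  · have hm : assocM M (1 / (k2 * Real.exp w.re)) ≤ assocM M (1 / (k2 * Real.exp X)) := by
      apply assoc_mono M hM _ _ (by positivity)
      gcongr
    refine (hgK w hwa).trans ?_
    rw [mul_assoc, ← Real.exp_add]
    exact le_mul_of_one_le_right hKpos.le (Real.one_le_exp (by linarith))
end
end

section
/- Let M = (M_p) be a logarithmically convex sequence of positive reals with M_0 = 1, whose quotients m_p := M_{p+1}/M_p tend to infinity, and which admits a nonzero proximate order, and let γ > 0. Suppose f is a bounded holomorphic function on the sector S_γ that admits a continuous extension to the boundary ∂S_γ and is M-flat in both boundary directions d = πγ/2 and −d = −πγ/2. Then there exist constants k1, k2 > 0 such that |f(z)| ≤ k1·e^{−M(1/(k2·|z|))} for every z with arg(z) ∈ [−πγ/2, πγ/2]. -/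
open Filter Topology Set
open scoped Real

noncomputable section

/-- Log-convexity gives the geometric lower bound `M_p ≥ m_0^p`. -/
lemma goodSeq_lower (M : ℕ → ℝ) (hM : GoodSeq M) (p : ℕ) : (M 1) ^ p ≤ M p := by
  obtain ⟨h0, hpos, hlc, -⟩ := hM
  have key : ∀ n, M 1 * M n ≤ M (n + 1) := by
    intro n
    induction n with
    | zero => simp [h0]
    | succ n ih =>
      have h1 := hlc n
      have h2 := hpos n
      have h3 := hpos (n + 1)
      have h4 : M n * (M 1 * M (n + 1)) ≤ M n * M (n + 2) := by nlinarith
      exact le_of_mul_le_mul_left h4 h2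
  induction p with
  | zero => simp [h0]
  | succ n ih =>
    calc M 1 ^ (n + 1) = M 1 * M 1 ^ n := by ring
      _ ≤ M 1 * M n := mul_le_mul_of_nonneg_left ih (hpos 1).le
      _ ≤ _ := key n

/-- A bounded function, flat near the vertex, satisfies the flatness bounds on the whole line. -/
lemma flat_line (M : ℕ → ℝ) (hM : GoodSeq M) (g : ℂ → ℂ) (D : Set ℂ) (θ K : ℝ)
    (hK : ∀ x : ℝ, ‖g ⟨x, θ⟩‖ ≤ K) (h : MFlatDir M g D θ) :
    ∃ C A : ℝ, 0 < C ∧ 0 < A ∧ ∀ x : ℝ, ∀ p : ℕ,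
      ‖g ⟨x, θ⟩‖ ≤ C * A ^ p * M p * Real.exp x ^ p := by
  obtain ⟨r, C, A, hr, hC, hA, -, hb⟩ := h
  have hlow := goodSeq_lower M hM
  obtain ⟨h0, hpos, hlc, -⟩ := hM
  have hK0 : 0 ≤ K := (norm_nonneg _).trans (hK 0)
  have h1 := hpos 1
  have hq : 0 < 1 / (r * M 1) := by positivity
  refine ⟨C + K, A + 1 / (r * M 1), by positivity, by positivity, fun x p => ?_⟩
  have hp := hpos p
  rcases le_or_gt x (Real.log r) with hx | hx
  · refine (hb x hx p).trans ?_
    have : A ^ p ≤ (A + 1 / (r * M 1)) ^ p := pow_le_pow_left₀ hA.le (by linarith) p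
    gcongr
    linarith
  · have hx' : r ≤ Real.exp x := by
      rw [← Real.exp_log hr]; exact Real.exp_le_exp.2 hx.le
    have e1 : 1 ≤ (1 / (r * M 1)) ^ p * M p * r ^ p := by
      calc (1 : ℝ) = (1 / (r * M 1)) ^ p * (M 1) ^ p * r ^ p := by
            rw [← mul_pow, ← mul_pow]; field_simp; simp
        _ ≤ _ := by gcongr; exact hlow p
    have e2 : (1 / (r * M 1)) ^ p * M p * r ^ p
        ≤ (A + 1 / (r * M 1)) ^ p * M p * Real.exp x ^ p := by
      gcongr
      linarith
    calc ‖g ⟨x, θ⟩‖ ≤ K := hK x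
      _ ≤ (C + K) * 1 := by linarith
      _ ≤ (C + K) * ((A + 1 / (r * M 1)) ^ p * M p * Real.exp x ^ p) := by
          gcongr; exact e1.trans e2
      _ = _ := by ring

/-- Lemma 3.4 of the paper: if the bounded holomorphic `f` on `S_γ`, with
continuous extension `g` to the closed sector, is `M`-flat in both boundary directions
`±πγ/2`, then it satisfies a uniform `M`-exponential decay bound on the whole closed
sector. -/
theorem mflat_extension_two_directions
    (M : ℕ → ℝ) (hM : GoodSeq M) (hPO : AdmitsNonzeroProximateOrder M)
    (γ : ℝ) (hγ0 : 0 < γ) (f g : ℂ → ℂ)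
    (hf : DifferentiableOn ℂ f (logSector 0 γ))
    (hbd : ∃ K : ℝ, ∀ w ∈ logSector 0 γ, ‖f w‖ ≤ K)
    (hg : ContinuousOn g {w : ℂ | |w.im| ≤ γ * π / 2})
    (hfg : ∀ w ∈ logSector 0 γ, g w = f w)
    (hflat₁ : MFlatDir M g {w : ℂ | |w.im| ≤ γ * π / 2} (γ * π / 2))
    (hflat₂ : MFlatDir M g {w : ℂ | |w.im| ≤ γ * π / 2} (-(γ * π / 2))) :
    ∃ k1 k2 : ℝ, 0 < k1 ∧ 0 < k2 ∧
      ∀ w : ℂ, -(γ * π / 2) ≤ w.im → w.im ≤ γ * π / 2 →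
        ‖g w‖ ≤ k1 * Real.exp (-assocM M (1 / (k2 * Real.exp w.re))) := by
  have hb0 : 0 < γ * π / 2 := by positivity
  have hset : logSector 0 γ = Complex.im ⁻¹' Ioo (-(γ * π / 2)) (γ * π / 2) := by
    ext w; simp [logSector, abs_lt]
  generalize γ * π / 2 = b at *
  have hcl : closure (Complex.im ⁻¹' Ioo (-b) b) = {w : ℂ | |w.im| ≤ b} := by
    rw [Complex.closure_preimage_im, closure_Ioo (by linarith)]
    ext w; simp [abs_le]
  rw [hset] at hf hbd hfg
  obtain ⟨K, hK⟩ := hbd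
  have hKc : ∀ w : ℂ, |w.im| ≤ b → ‖g w‖ ≤ K := by
    intro w hw
    have hw' : w ∈ closure (Complex.im ⁻¹' Ioo (-b) b) := by rw [hcl]; exact hw
    have hc : ContinuousOn (fun w => ‖g w‖) (closure (Complex.im ⁻¹' Ioo (-b) b)) := by
      rw [hcl]; exact hg.norm
    refine le_on_closure (f := fun w => ‖g w‖) (g := fun _ => K) ?_ hc continuousOn_const hw'
    intro z hz
    simp only [hfg z hz]
    exact hK z hz
  have hgd : DiffContOnCl ℂ g (Complex.im ⁻¹' Ioo (-b) b) :=
    ⟨hf.congr hfg, by rw [hcl]; exact hg⟩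
  obtain ⟨C₁, A₁, hC₁, hA₁, h₁⟩ := flat_line M hM g _ b K
    (fun x => hKc _ (by simp [abs_of_pos hb0])) hflat₁
  obtain ⟨C₂, A₂, hC₂, hA₂, h₂⟩ := flat_line M hM g _ (-b) K
    (fun x => hKc _ (by simp [abs_of_pos hb0])) hflat₂
  obtain ⟨h0, hpos, -, -⟩ := hM
  have hK0 : 0 ≤ K := (norm_nonneg _).trans (hKc 0 (by simpa using hb0.le))
  have nexp : ∀ (p : ℕ) (z : ℂ), ‖g z * Complex.exp (-(p * z))‖
      = ‖g z‖ * (Real.exp z.re ^ p)⁻¹ := by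
    intro p z
    rw [norm_mul, Complex.norm_exp, ← Real.exp_nat_mul, ← Real.exp_neg]
    simp
  have main : ∀ (p : ℕ) (w : ℂ), -b ≤ w.im → w.im ≤ b →
      ‖g w‖ ≤ (C₁ + C₂) * (A₁ + A₂) ^ p * M p * Real.exp w.re ^ p := by
    intro p w hw1 hw2
    have hp := hpos p
    have bdry : ∀ z : ℂ, ∀ C A : ℝ, 0 < C → 0 < A → C ≤ C₁ + C₂ → A ≤ A₁ + A₂ →
        ‖g z‖ ≤ C * A ^ p * M p * Real.exp z.re ^ p →
        ‖g z * Complex.exp (-(p * z))‖ ≤ (C₁ + C₂) * (A₁ + A₂) ^ p * M p := by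
      intro z C A hC hA hC' hA' hz
      rw [nexp, ← div_eq_mul_inv, div_le_iff₀ (by positivity)]
      refine hz.trans ?_
      gcongr
    have := PhragmenLindelof.horizontal_strip (a := -b) (b := b)
      (f := fun z => g z * Complex.exp (-(p * z)))
      (C := (C₁ + C₂) * (A₁ + A₂) ^ p * M p) (z := w)
      (hgd.smul (Differentiable.diffContOnCl (by fun_prop)))
      ?_ ?_ ?_ hw1 hw2
    · rw [nexp, ← div_eq_mul_inv, div_le_iff₀ (by positivity)] at this
      exact this
    · have hcpos : 0 < π / (b - -b) := by
        have := Real.pi_pos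
        have : 0 < b - -b := by linarith
        positivity
      set c := π / (b - -b) / 2 with hc
      have hc0 : 0 < c := by positivity
      refine ⟨c, by rw [hc]; linarith, p / c, ?_⟩
      refine Asymptotics.IsBigO.of_bound K ?_
      refine Filter.eventually_inf_principal.2 (Eventually.of_forall fun z hz => ?_)
      rw [nexp, Real.norm_of_nonneg (Real.exp_pos _).le, ← Real.exp_nat_mul, ← Real.exp_neg]
      refine mul_le_mul (hKc z ?_) (Real.exp_le_exp.2 ?_) (Real.exp_pos _).le hK0
      · have h3 : -b < z.im ∧ z.im < b := by simpa using hz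
        exact abs_le.2 ⟨h3.1.le, h3.2.le⟩
      · have h4 : c * |z.re| ≤ Real.exp (c * |z.re|) :=
          (by linarith : c * |z.re| ≤ c * |z.re| + 1).trans (Real.add_one_le_exp _)
        calc -(p * z.re) = p * (-z.re) := by ring
          _ ≤ p * |z.re| := by gcongr; exact neg_le_abs _
          _ = p / c * (c * |z.re|) := by field_simp
          _ ≤ _ := by gcongr
    · intro z hz
      refine bdry z C₂ A₂ hC₂ hA₂ (by linarith) (by linarith) ?_
      have := h₂ z.re p
      rwa [← hz] at this
    · intro z hz
      refine bdry z C₁ A₁ hC₁ hA₁ (by linarith) (by linarith) ?_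
      have := h₁ z.re p
      rwa [← hz] at this
  refine ⟨C₁ + C₂, A₁ + A₂, by positivity, by positivity, fun w hw1 hw2 => ?_⟩
  rcases (norm_nonneg (g w)).eq_or_lt with hz | hz
  · rw [← hz]; positivity
  have hC : 0 < C₁ + C₂ := by positivity
  have hA : 0 < A₁ + A₂ := by positivity
  have hsup : assocM M (1 / ((A₁ + A₂) * Real.exp w.re))
      ≤ Real.log ((C₁ + C₂) / ‖g w‖) := by
    refine ciSup_le fun p => ?_
    have hp := hpos p
    refine Real.log_le_log (by positivity) ?_
    have := main p w hw1 hw2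
    rw [one_div, inv_pow, mul_pow, inv_eq_one_div, div_div, div_le_div_iff₀ (by positivity) hz]
    linarith
  calc ‖g w‖ = (C₁ + C₂) * Real.exp (-Real.log ((C₁ + C₂) / ‖g w‖)) := by
        rw [Real.exp_neg, Real.exp_log (by positivity)]; field_simp
    _ ≤ _ := by gcongr
end
end

section
/- Let M = (M_p) be a logarithmically convex sequence of positive reals with M_0 = 1, whose quotients m_p := M_{p+1}/M_p tend to infinity, and which admits a nonzero proximate order, and let 0 < γ < ω(M). Suppose f is a bounded holomorphic function on the sector S_γ that admits a continuous extension to the boundary ∂S_γ and is Beurling M-flat in the direction d = πγ/2. Then for every 0 < δ < πγ and every k2 > 0 there exists a constant k1 = k1(δ, k2) > 0 such that |f(z)| ≤ k1·e^{−M(1/(k2·|z|))} for every z with arg(z) ∈ [−πγ/2 + δ, πγ/2]. -/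
open Filter Topology Set
open scoped Real

noncomputable section

lemma assocM_bdd {M : ℕ → ℝ} (hM : GoodSeq M) {t : ℝ} (ht : 0 < t) :
    BddAbove (range fun p : ℕ => Real.log (t ^ p / M p)) := by
  obtain ⟨h0, hpos, -, hlim⟩ := hM
  obtain ⟨N, hN⟩ := eventually_atTop.1 (hlim.eventually_ge_atTop t)
  have key : ∀ p ≥ N, Real.log (t ^ p / M p) ≤ Real.log (t ^ N / M N) := by
    intro p hp
    induction p, hp using Nat.le_induction with
    | base => exact le_rfl
    | succ p hp ih =>
      refine le_trans ?_ ih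
      have h1 := hpos p
      have h2 := hpos (p + 1)
      apply Real.log_le_log (by positivity)
      rw [div_le_div_iff₀ h2 h1, pow_succ]
      have := hN p hp
      rw [le_div_iff₀ h1] at this
      nlinarith [pow_pos ht p]
  apply Filter.IsBoundedUnder.bddAbove_range
  exact ⟨Real.log (t ^ N / M N), by
    rw [Filter.eventually_map]
    exact eventually_atTop.2 ⟨N, key⟩⟩

lemma assocM_ge {M : ℕ → ℝ} (hM : GoodSeq M) {t : ℝ} (ht : 0 < t) (p : ℕ) :
    Real.log (t ^ p / M p) ≤ assocM M t :=
  le_ciSup (assocM_bdd hM ht) p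

lemma assocM_nonneg {M : ℕ → ℝ} (hM : GoodSeq M) {t : ℝ} (ht : 0 < t) : 0 ≤ assocM M t := by
  have := assocM_ge hM ht 0
  simpa [hM.1] using this

lemma assocM_mono {M : ℕ → ℝ} (hM : GoodSeq M) {s t : ℝ} (hs : 0 < s) (hst : s ≤ t) :
    assocM M s ≤ assocM M t := by
  refine ciSup_le fun p => le_trans ?_ (assocM_ge hM (hs.trans_le hst) p)
  have := hM.2.1 p
  apply Real.log_le_log (by positivity)
  gcongr

lemma assocM_pos {M : ℕ → ℝ} (hM : GoodSeq M) : ∀ᶠ t in atTop, 0 < assocM M t := by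
  have h1 := hM.2.1 1
  filter_upwards [eventually_gt_atTop (M 1)] with t ht
  have := assocM_ge hM (h1.trans ht) 1
  refine lt_of_lt_of_le (Real.log_pos ?_) this
  rw [pow_one, lt_div_iff₀ h1]
  linarith

lemma mono_off_finite (F F' : ℝ → ℝ) (E : Set ℝ) (n : ℕ) : ∀ x y : ℝ, x ≤ y →
    ContinuousOn F (Icc x y) → (∀ r ∈ Ioo x y \ E, HasDerivAt F (F' r) r) →
    (∀ r ∈ Ioo x y \ E, 0 ≤ F' r) → (E ∩ Ioo x y).Finite → (E ∩ Ioo x y).ncard ≤ n →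
    F x ≤ F y := by
  induction n with
  | zero =>
    intro x y hxy hc hd hn hf hcard
    have hE : E ∩ Ioo x y = ∅ := by
      rw [← Set.ncard_eq_zero hf]; omega
    have hnot : ∀ r ∈ Ioo x y, r ∈ Ioo x y \ E := fun r hr =>
      ⟨hr, fun hrE => by
        have : r ∈ E ∩ Ioo x y := ⟨hrE, hr⟩
        rw [hE] at this; exact this⟩
    refine monotoneOn_of_hasDerivWithinAt_nonneg (f' := F') (convex_Icc x y) hc ?_ ?_
      (left_mem_Icc.2 hxy) (right_mem_Icc.2 hxy) hxy
    · intro r hr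
      rw [interior_Icc] at hr
      exact (hd r (hnot r hr)).hasDerivWithinAt
    · intro r hr
      rw [interior_Icc] at hr
      exact hn r (hnot r hr)
  | succ n ih =>
    intro x y hxy hc hd hn hf hcard
    by_cases hE : (E ∩ Ioo x y) = ∅
    · exact ih x y hxy hc hd hn hf (by rw [hE]; simp)
    obtain ⟨e, heE, he⟩ := Set.nonempty_iff_ne_empty.2 hE
    have s1 : Ioo x e ⊆ Ioo x y := Ioo_subset_Ioo le_rfl he.2.le
    have s2 : Ioo e y ⊆ Ioo x y := Ioo_subset_Ioo he.1.le le_rfl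
    have c1 : (E ∩ Ioo x e).ncard < (E ∩ Ioo x y).ncard := by
      apply Set.ncard_lt_ncard _ hf
      refine ⟨inter_subset_inter_right _ s1, fun h => ?_⟩
      exact lt_irrefl e (h ⟨heE, he⟩).2.2
    have c2 : (E ∩ Ioo e y).ncard < (E ∩ Ioo x y).ncard := by
      apply Set.ncard_lt_ncard _ hf
      refine ⟨inter_subset_inter_right _ s2, fun h => ?_⟩
      exact lt_irrefl e (h ⟨heE, he⟩).2.1
    have a1 := ih x e he.1.le (hc.mono (Icc_subset_Icc le_rfl he.2.le))
      (fun r hr => hd r ⟨s1 hr.1, hr.2⟩) (fun r hr => hn r ⟨s1 hr.1, hr.2⟩)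
      (hf.subset (inter_subset_inter_right _ s1)) (by omega)
    have a2 := ih e y he.2.le (hc.mono (Icc_subset_Icc he.1.le le_rfl))
      (fun r hr => hd r ⟨s2 hr.1, hr.2⟩) (fun r hr => hn r ⟨s2 hr.1, hr.2⟩)
      (hf.subset (inter_subset_inter_right _ s2)) (by omega)
    exact a1.trans a2

/-- For a nonzero proximate order, `ρ(t) log t - (ℓ/2) log t` is eventually nondecreasing. -/
lemma prox_mono {c ℓ : ℝ} {ρ : ℝ → ℝ} (hℓ : 0 < ℓ) (h : IsProximateOrder c ρ ℓ) :
    ∃ T : ℝ, ∀ x y, T ≤ x → x ≤ y →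
      ρ x * Real.log x - ℓ / 2 * Real.log x ≤ ρ y * Real.log y - ℓ / 2 * Real.log y := by
  obtain ⟨hc, -, hlim, E, ρ', hfin, hd, -, -, hl⟩ := h
  have e1 : ∀ᶠ r in atTop, 3 * ℓ / 4 < ρ r := hlim.eventually_const_lt (by linarith)
  have e2 := hl.eventually_const_lt (show -(ℓ / 4) < 0 by linarith)
  rw [eventually_inf_principal] at e2
  obtain ⟨T, hT⟩ := eventually_atTop.1 (e1.and e2)
  refine ⟨max T (max (c + 1) 1), fun x y hx hxy => ?_⟩
  have hxT : T ≤ x := (le_max_left _ _).trans hx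
  have hxc : c < x := by
    have := ((le_max_left (c + 1) 1).trans (le_max_right T _)).trans hx
    linarith
  have hx1 : 1 ≤ x := ((le_max_right (c + 1) 1).trans (le_max_right T _)).trans hx
  refine mono_off_finite (fun r => ρ r * Real.log r - ℓ / 2 * Real.log r)
    (fun r => ρ' r * Real.log r + ρ r * r⁻¹ - ℓ / 2 * r⁻¹) E _ x y hxy ?_ ?_ ?_ ?_ le_rfl
  · have hlog : ContinuousOn Real.log (Icc x y) :=
      Real.continuousOn_log.mono fun r hr => by
        have : 0 < r := by linarith [hr.1]
        exact this.ne'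
    have hρ : ContinuousOn ρ (Icc x y) := hc.mono fun r hr => lt_of_lt_of_le hxc hr.1
    exact (hρ.mul hlog).sub (continuousOn_const.mul hlog)
  · intro r hr
    have hr0 : r ≠ 0 := by
      have : 0 < r := by linarith [hr.1.1]
      exact this.ne'
    have h1 := hd r ⟨hxc.trans hr.1.1, hr.2⟩
    have h2 := Real.hasDerivAt_log hr0
    exact (h1.mul h2).sub (h2.const_mul (ℓ / 2))
  · intro r hr
    have hr0 : 0 < r := by linarith [hr.1.1]
    obtain ⟨q1, q2⟩ := hT r (hxT.trans hr.1.1.le)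
    have q3 := q2 ⟨hxc.trans hr.1.1, hr.2⟩
    have : ρ' r * Real.log r + ρ r * r⁻¹ - ℓ / 2 * r⁻¹
        = (r * ρ' r * Real.log r + ρ r - ℓ / 2) * r⁻¹ := by
      field_simp
    rw [this]
    exact mul_nonneg (by linarith) (inv_pos.2 hr0).le
  · exact (hfin y).subset (inter_subset_inter_right _ fun r hr => hr.2.le)

lemma assocM_growth {M : ℕ → ℝ} (hM : GoodSeq M) (hPO : AdmitsNonzeroProximateOrder M)
    {η : ℝ} (hη : 0 < η) :
    ∃ l C : ℝ, 0 < l ∧ ∀ t : ℝ, 0 < t → assocM M t - C ≤ η * assocM M (l * t) := by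
  obtain ⟨c, ℓ, ρ, hℓ, hρ, A, B, hAB⟩ := hPO
  obtain ⟨T0, hT0⟩ := prox_mono hℓ hρ
  obtain ⟨T1, hT1⟩ := eventually_atTop.1 (hAB.and (assocM_pos hM))
  set T := max T0 (max T1 2) with hT
  have t0 : T0 ≤ T := le_max_left _ _
  have t1 : T1 ≤ T := (le_max_left _ _).trans (le_max_right _ _)
  have t2 : 2 ≤ T := (le_max_right _ _).trans (le_max_right _ _)
  -- choose the dilation factor
  set L := max 0 (2 / ℓ * (B - A - Real.log η)) with hL
  have hL0 : 0 ≤ L := le_max_left _ _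
  have hL1 : B - A - Real.log η ≤ ℓ / 2 * L := by
    have : 2 / ℓ * (B - A - Real.log η) ≤ L := le_max_right _ _
    calc B - A - Real.log η = ℓ / 2 * (2 / ℓ * (B - A - Real.log η)) := by field_simp
      _ ≤ _ := by gcongr
  have hl1 : 1 ≤ Real.exp L := Real.one_le_exp hL0
  refine ⟨Real.exp L, assocM M T, Real.exp_pos _, fun t ht => ?_⟩
  rcases le_total t T with h | h
  · have h1 := assocM_mono hM ht h
    have h2 := assocM_nonneg hM (show 0 < Real.exp L * t by positivity)
    have := mul_nonneg hη.le h2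
    linarith
  · have htl : t ≤ Real.exp L * t := le_mul_of_one_le_left ht.le hl1
    have m := hT0 t (Real.exp L * t) (t0.trans h) htl
    obtain ⟨⟨a1, a2⟩, a3⟩ := hT1 t (t1.trans h)
    obtain ⟨⟨b1, b2⟩, b3⟩ := hT1 (Real.exp L * t) ((t1.trans h).trans htl)
    have lt : 0 < Real.log t := Real.log_pos (by linarith)
    have llt : 0 < Real.log (Real.exp L * t) := Real.log_pos (by linarith)
    rw [mul_sub, mul_div_cancel₀ _ lt.ne'] at a1 a2
    rw [mul_sub, mul_div_cancel₀ _ llt.ne'] at b1 b2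
    have hlog : Real.log (Real.exp L * t) = L + Real.log t := by
      rw [Real.log_mul (Real.exp_pos _).ne' ht.ne', Real.log_exp]
    have key : Real.log (assocM M t) ≤ Real.log (η * assocM M (Real.exp L * t)) := by
      rw [Real.log_mul hη.ne' b3.ne']
      rw [hlog] at m b2
      nlinarith
    have := (Real.log_le_log_iff a3 (by positivity)).1 key
    linarith [assocM_nonneg hM (show 0 < T by linarith)]

/-- A local two-constants estimate on a horizontal strip. -/
lemma two_const {a : ℝ} (ha : 0 < a) {g : ℂ → ℂ}
    (hg : DiffContOnCl ℂ g (Complex.im ⁻¹' Ioo (-a) a)) {K ε : ℝ} (hε : 0 < ε) (hεK : ε ≤ K)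
    (hK : ∀ w : ℂ, -a ≤ w.im → w.im ≤ a → ‖g w‖ ≤ K) (x : ℝ)
    (htop : ∀ w : ℂ, w.im = a → w.re ≤ x + 2 * a → ‖g w‖ ≤ ε)
    {w : ℂ} (hwx : w.re = x) (hw1 : -a ≤ w.im) (hw2 : w.im ≤ a) :
    ‖g w‖ ≤ K * Real.exp (-(Real.log (K / ε) * ((w.im + a) ^ 2 / (4 * a ^ 2)))) := by
  have hK0 : 0 < K := hε.trans_le hεK
  set N := Real.log (K / ε) / (4 * a ^ 2) with hN
  have hN0 : 0 ≤ N := div_nonneg (Real.log_nonneg (by rwa [le_div_iff₀ hε, one_mul])) (by positivity)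
  set h : ℂ → ℂ := fun z => Complex.exp (-(N : ℂ) * (z + (a : ℂ) * Complex.I - (x : ℂ)) ^ 2) with hh
  have hnorm : ∀ z, ‖h z‖ = Real.exp (N * ((z.im + a) ^ 2 - (z.re - x) ^ 2)) := by
    intro z
    simp only [hh, Complex.norm_exp]
    congr 1
    simp [pow_two]
    ring
  have hhd : Differentiable ℂ h := by
    simp only [hh]; fun_prop
  have hfd : DiffContOnCl ℂ (fun z => h z • g z) (Complex.im ⁻¹' Ioo (-a) a) :=
    hhd.diffContOnCl.smul hg
  have main : ‖h w • g w‖ ≤ K := by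
    refine PhragmenLindelof.horizontal_strip (f := fun z => h z • g z) hfd ?_ ?_ ?_ hw1 hw2
    · refine ⟨0, by have : 0 < a - -a := by linarith
                    positivity, 0, ?_⟩
      refine Asymptotics.IsBigO.of_bound (Real.exp (N * (2 * a) ^ 2) * K) ?_
      rw [eventually_inf_principal]
      refine Eventually.of_forall fun z hz => ?_
      have hz' : -a < z.im ∧ z.im < a := hz
      rw [norm_smul, hnorm]
      simp only [zero_mul, Real.exp_zero, norm_one, mul_one]
      refine mul_le_mul (Real.exp_le_exp.2 ?_) (hK z hz'.1.le hz'.2.le) (norm_nonneg _)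
        (Real.exp_pos _).le
      apply mul_le_mul_of_nonneg_left _ hN0
      nlinarith [sq_nonneg (z.re - x), hz'.1, hz'.2]
    · intro z hz
      rw [norm_smul, hnorm, hz]
      have : Real.exp (N * ((-a + a) ^ 2 - (z.re - x) ^ 2)) ≤ 1 := by
        rw [Real.exp_le_one_iff]
        nlinarith [mul_nonneg hN0 (sq_nonneg (z.re - x))]
      calc _ ≤ 1 * ‖g z‖ := by gcongr
        _ ≤ K := by rw [one_mul]; exact hK z hz.ge (by linarith)
    · intro z hz
      rw [norm_smul, hnorm, hz]
      rcases le_or_gt z.re (x + 2 * a) with hr | hr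
      · have h1 := htop z hz hr
        have h2 : Real.exp (N * ((a + a) ^ 2 - (z.re - x) ^ 2)) ≤ K / ε := by
          rw [← Real.exp_log (div_pos hK0 hε), Real.exp_le_exp]
          have : Real.log (K / ε) = N * (4 * a ^ 2) := by
            rw [hN]; field_simp
          rw [this]
          nlinarith [mul_nonneg hN0 (sq_nonneg (z.re - x))]
        calc _ ≤ K / ε * ε := by gcongr
          _ = K := by field_simp
      · have : Real.exp (N * ((a + a) ^ 2 - (z.re - x) ^ 2)) ≤ 1 := by
          rw [Real.exp_le_one_iff]
          apply mul_nonpos_of_nonneg_of_nonpos hN0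
          nlinarith
        calc _ ≤ 1 * ‖g z‖ := by gcongr
          _ ≤ K := by rw [one_mul]; exact hK z (by linarith) hz.le
  rw [norm_smul, hnorm, hwx] at main
  have e : Real.log (K / ε) * ((w.im + a) ^ 2 / (4 * a ^ 2)) = N * ((w.im + a) ^ 2 - (x - x) ^ 2) := by
    rw [hN]; field_simp; ring
  rw [e, Real.exp_neg, ← div_eq_mul_inv, le_div_iff₀ (Real.exp_pos _), mul_comm]
  exact main

/-- Remark 3.9 of the paper, Beurling version of Lemma 3.2: for
`0 < γ < ω(M)`, if the bounded holomorphic `f` on `S_γ`, with continuous extension `g` to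
the closed sector, is Beurling `M`-flat in direction `πγ/2`, then for every `0 < δ < πγ`
and every `k2 > 0` there is `k1 > 0` bounding `|f|` by `k1 e^{−M(1/(k2|z|))}` in the
directions `[−πγ/2 + δ, πγ/2]`. -/
theorem beurling_mflat_extension
    (M : ℕ → ℝ) (hM : GoodSeq M) (hPO : AdmitsNonzeroProximateOrder M)
    (γ : ℝ) (hγ0 : 0 < γ) (hγω : γ < omegaM M) (f g : ℂ → ℂ)
    (hf : DifferentiableOn ℂ f (logSector 0 γ))
    (hbd : ∃ K : ℝ, ∀ w ∈ logSector 0 γ, ‖f w‖ ≤ K)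
    (hg : ContinuousOn g {w : ℂ | |w.im| ≤ γ * π / 2})
    (hfg : ∀ w ∈ logSector 0 γ, g w = f w)
    (hflat : BeurlingFlatDir M g {w : ℂ | |w.im| ≤ γ * π / 2} (γ * π / 2)) :
    ∀ δ : ℝ, 0 < δ → δ < π * γ → ∀ k2 : ℝ, 0 < k2 →
      ∃ k1 : ℝ, 0 < k1 ∧
        ∀ w : ℂ, -(γ * π / 2) + δ ≤ w.im → w.im ≤ γ * π / 2 →
          ‖g w‖ ≤ k1 * Real.exp (-assocM M (1 / (k2 * Real.exp w.re))) := by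
  intro δ hδ hδγ k2 hk2
  set a := γ * π / 2 with ha
  have ha0 : 0 < a := by positivity
  obtain ⟨K0, hK0⟩ := hbd
  have hset : logSector 0 γ = Complex.im ⁻¹' Ioo (-a) a := by
    ext w
    simp [logSector, abs_lt, ha]
  have hcl : closure (Complex.im ⁻¹' Ioo (-a) a) = {w : ℂ | |w.im| ≤ a} := by
    rw [Complex.closure_preimage_im, closure_Ioo (by linarith)]
    ext w
    simp [abs_le]
  rw [hset] at hf hfg hK0
  have hgd : DiffContOnCl ℂ g (Complex.im ⁻¹' Ioo (-a) a) :=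
    ⟨hf.congr hfg, by rw [hcl]; exact hg⟩
  have hgK : ∀ w : ℂ, -a ≤ w.im → w.im ≤ a → ‖g w‖ ≤ K0 := by
    intro w h1 h2
    have hw : w ∈ closure (Complex.im ⁻¹' Ioo (-a) a) := by
      rw [hcl]; exact abs_le.2 ⟨h1, h2⟩
    exact le_on_closure (fun z hz => by rw [hfg z hz]; exact hK0 z hz)
      hgd.continuousOn.norm continuousOn_const hw
  set η := δ ^ 2 / (4 * a ^ 2) with hη
  have hη0 : 0 < η := by positivity
  obtain ⟨l, C, hl, hgrow⟩ := assocM_growth hM hPO hη0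
  obtain ⟨c1, hc1, hflat'⟩ := hflat (k2 * Real.exp (-(2 * a)) / l) (by positivity)
  set K := max K0 c1 with hKdef
  have hKc : c1 ≤ K := le_max_right _ _
  have hKpos : 0 < K := hc1.trans_le hKc
  refine ⟨K * Real.exp C, by positivity, fun w hw1 hw2 => ?_⟩
  set t := 1 / (k2 * Real.exp w.re) with ht
  have ht0 : 0 < t := by positivity
  have hMl := assocM_nonneg hM (mul_pos hl ht0)
  have h := two_const ha0 hgd (K := K) (ε := K * Real.exp (-assocM M (l * t))) (by positivity)
    (mul_le_of_le_one_right hKpos.le (Real.exp_le_one_iff.2 (by linarith)))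
    (fun z h1 h2 => (hgK z h1 h2).trans (le_max_left _ _)) w.re ?_ rfl (by linarith) hw2
  · refine h.trans ?_
    rw [mul_assoc, ← Real.exp_add]
    apply mul_le_mul_of_nonneg_left _ hKpos.le
    rw [Real.exp_le_exp]
    have e : Real.log (K / (K * Real.exp (-assocM M (l * t)))) = assocM M (l * t) := by
      rw [Real.exp_neg]
      have : K / (K * (Real.exp (assocM M (l * t)))⁻¹) = Real.exp (assocM M (l * t)) := by
        field_simp
      rw [this, Real.log_exp]
    rw [e]
    have h1 : η ≤ (w.im + a) ^ 2 / (4 * a ^ 2) := by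
      rw [hη]
      have : δ ≤ w.im + a := by linarith
      gcongr
    have h2 := hgrow t ht0
    nlinarith [mul_le_mul_of_nonneg_left h1 hMl]
  · intro z hz hzr
    refine (hflat' z ?_ hz).trans ?_
    · show |z.im| ≤ a
      rw [hz, abs_of_pos ha0]
    · apply mul_le_mul hKc _ (Real.exp_pos _).le hKpos.le
      rw [Real.exp_le_exp, neg_le_neg_iff]
      apply assocM_mono hM (mul_pos hl ht0)
      have : l * t = 1 / (k2 * Real.exp (-(2 * a)) / l * Real.exp (w.re + 2 * a)) := by
        rw [ht, Real.exp_add, Real.exp_neg]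
        field_simp
      rw [this]
      gcongr
end
end

section
/- Let M = (M_p) be a logarithmically convex sequence of positive reals with M_0 = 1, whose quotients m_p := M_{p+1}/M_p tend to infinity, and which admits a nonzero proximate order. Let γ > 0 satisfy either γ > ω(M), or γ = ω(M) together with the divergence of the series Σ_{p≥0} (m_p)^{−1/ω(M)}. Suppose f is a bounded holomorphic function on the sector S_γ that admits a continuous extension to the boundary ∂S_γ and is M-flat in the single boundary direction d = πγ/2. Then f ≡ 0. -/
open Filter Topology Set
open scoped Real

noncomputable section

/-! ### Auxiliary harmonic function -/

/-- The building block of the comparison function. -/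
def wth (σ : ℂ) : ℂ := -Complex.log (1 + σ) + (3 / 4 : ℝ) * (σ / (1 + σ))

lemma wth_re (σ : ℂ) :
    (wth σ).re = -Real.log ‖1 + σ‖ + 3 / 4 * (σ / (1 + σ)).re := by
  simp only [wth, Complex.add_re, Complex.neg_re, Complex.log_re, Complex.re_ofReal_mul]

lemma div_re_formula (σ : ℂ) :
    (σ / (1 + σ)).re = (σ.re * (1 + σ.re) + σ.im ^ 2) / ((1 + σ.re) ^ 2 + σ.im ^ 2) := by
  rw [Complex.div_re, Complex.normSq_apply]
  simp only [Complex.add_re, Complex.add_im, Complex.one_re, Complex.one_im, zero_add]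
  rw [← add_div]
  ring_nf

lemma div_re_nonneg {σ : ℂ} (h : 0 ≤ σ.re) : 0 ≤ (σ / (1 + σ)).re := by
  rw [div_re_formula]
  positivity

lemma wth_boundary {σ : ℂ} (hre : σ.re = 0) (h0 : 0 < ‖σ‖) :
    min 0 (-Real.log (2 * ‖σ‖)) ≤ (wth σ).re := by
  have hn : ‖σ‖ ^ 2 = σ.im ^ 2 := by
    rw [← Complex.normSq_eq_norm_sq, Complex.normSq_apply, hre]; ring
  have h1 : ‖1 + σ‖ ^ 2 = 1 + ‖σ‖ ^ 2 := by
    rw [hn, ← Complex.normSq_eq_norm_sq, Complex.normSq_apply]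
    simp [hre]; ring
  have h1pos : 0 < ‖1 + σ‖ := by
    by_contra h
    have : ‖1 + σ‖ = 0 := le_antisymm (not_lt.mp h) (norm_nonneg _)
    rw [this] at h1; nlinarith [sq_nonneg ‖σ‖]
  rw [wth_re, div_re_formula, hre, ← hn]
  set Y := ‖σ‖
  have e : (0 * (1 + 0) + Y ^ 2) / ((1 + 0) ^ 2 + Y ^ 2) = Y ^ 2 / (1 + Y ^ 2) := by ring_nf
  rw [e]
  have hlog : Real.log ‖1 + σ‖ = 1 / 2 * Real.log (1 + Y ^ 2) := by
    rw [← h1, Real.log_pow]; push_cast; ring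
  have hq : 0 ≤ Y ^ 2 / (1 + Y ^ 2) := by positivity
  by_cases hY : Y ^ 2 ≤ 1 / 2
  · refine (min_le_left _ _).trans ?_
    have h2 : Real.log (1 + Y ^ 2) ≤ Y ^ 2 := by
      have := Real.log_le_sub_one_of_pos (x := 1 + Y ^ 2) (by positivity)
      linarith
    have h3 : 1 / 2 * Y ^ 2 ≤ 3 / 4 * (Y ^ 2 / (1 + Y ^ 2)) := by
      rw [← mul_div_assoc, le_div_iff₀ (by positivity)]
      nlinarith [sq_nonneg Y]
    rw [hlog]; linarith
  · refine (min_le_right _ _).trans ?_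
    have h2 : ‖1 + σ‖ ≤ 2 * Y := by
      refine (sq_le_sq₀ (norm_nonneg _) (by positivity)).mp ?_
      rw [h1]; nlinarith
    have := Real.log_le_log h1pos h2
    linarith

lemma wth_min_le {γ t : ℝ} (hγ : 0 < γ) {σ : ℂ} (hre : σ.re = 0) (h0 : 0 < ‖σ‖)
    (ht : t = (2 * ‖σ‖) ^ (-γ)) : min 1 t ≤ Real.exp (γ * (wth σ).re) := by
  have h := wth_boundary hre h0
  rw [ht, Real.rpow_def_of_pos (by positivity)]
  rcases min_le_iff.mp h with h | h
  · refine (min_le_left _ _).trans (Real.one_le_exp (by positivity))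
  · refine (min_le_right _ _).trans (Real.exp_le_exp.mpr ?_)
    nlinarith

/-- On the positive reals the comparison function is negative. -/
lemma wth_real {s : ℝ} (h0 : 0 < s) (h1 : s ≤ 1) : (wth (s : ℂ)).re ≤ -(s / 8) := by
  rw [wth_re, div_re_formula]
  simp only [Complex.ofReal_re, Complex.ofReal_im]
  have hn : ‖(1 : ℂ) + s‖ = 1 + s := by
    rw [← Complex.ofReal_one, ← Complex.ofReal_add, Complex.norm_real, Real.norm_eq_abs,
      abs_of_pos (by positivity)]
  rw [hn]
  have hl := Real.one_sub_inv_le_log_of_pos (x := 1 + s) (by positivity)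
  have e1 : 1 - (1 + s)⁻¹ = s / (1 + s) := by field_simp; ring
  have e2 : (s * (1 + s) + 0 ^ 2) / ((1 + s) ^ 2 + 0 ^ 2) = s / (1 + s) := by field_simp; ring
  rw [e2]; rw [e1] at hl
  have : s / 2 ≤ s / (1 + s) := by
    apply div_le_div_of_nonneg_left h0.le (by positivity) (by linarith)
  linarith

/-- Growth bound. -/
lemma neg_wth_le {σ : ℂ} (h : 0 ≤ σ.re) : -(wth σ).re ≤ 2 * (1 + Real.sqrt ‖σ‖) := by
  rw [wth_re]
  have h1 := div_re_nonneg h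
  have h2 : Real.log ‖1 + σ‖ ≤ 2 * (1 + Real.sqrt ‖σ‖) := by
    have hpos : 0 < ‖1 + σ‖ := by
      rw [norm_pos_iff]; intro h0
      have := congrArg Complex.re h0
      simp at this; linarith
    have hle : ‖1 + σ‖ ≤ (1 + Real.sqrt ‖σ‖) ^ 2 := by
      have := norm_add_le (1 : ℂ) σ
      rw [norm_one] at this
      have := Real.sq_sqrt (norm_nonneg σ)
      nlinarith [Real.sqrt_nonneg ‖σ‖]
    have := Real.log_le_log hpos hle
    rw [Real.log_pow] at this
    have h3 := Real.log_le_sub_one_of_pos (x := 1 + Real.sqrt ‖σ‖)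
      (by positivity)
    push_cast at this
    linarith
  linarith

/-! ### Phragmen-Lindelof -/

lemma exp_re_nonneg {γ : ℝ} (hγ : 0 < γ) {w : ℂ} (hw : |w.im| ≤ γ * π / 2) {c : ℝ} (hc : 0 < c) :
    0 ≤ ((c : ℂ) * Complex.exp (-w / γ)).re := by
  rw [Complex.re_ofReal_mul, Complex.exp_re]
  have : (-w / (γ : ℂ)).im = -w.im / γ := by rw [Complex.div_ofReal_im, Complex.neg_im]
  rw [this]
  have h := abs_le.mp hw
  have : 0 ≤ Real.cos (-w.im / γ) := by
    apply Real.cos_nonneg_of_neg_pi_div_two_le_of_le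
    · rw [le_div_iff₀ hγ]; linarith
    · rw [div_le_iff₀ hγ]; linarith
  positivity

lemma exp_re_zero {γ : ℝ} (hγ : 0 < γ) {w : ℂ} (hw : |w.im| = γ * π / 2) {c : ℝ} :
    ((c : ℂ) * Complex.exp (-w / γ)).re = 0 := by
  rw [Complex.re_ofReal_mul, Complex.exp_re]
  have : (-w / (γ : ℂ)).im = -w.im / γ := by rw [Complex.div_ofReal_im, Complex.neg_im]
  rw [this]
  have : Real.cos (-w.im / γ) = 0 := by
    rw [← Real.cos_abs, abs_div, abs_neg, hw, abs_of_pos hγ]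
    rw [show γ * π / 2 / γ = π / 2 by field_simp]
    exact Real.cos_pi_div_two
  rw [this]; simp

lemma exp_norm {γ : ℝ} {w : ℂ} {c : ℝ} (hc : 0 < c) :
    ‖(c : ℂ) * Complex.exp (-w / γ)‖ = c * Real.exp (-w.re / γ) := by
  rw [norm_mul, Complex.norm_real, Complex.norm_exp, Complex.div_ofReal_re, Complex.neg_re,
    Real.norm_of_nonneg hc.le]

lemma wth_differentiableAt {σ : ℂ} (h : 0 ≤ σ.re) : DifferentiableAt ℂ wth σ := by
  have hs : 1 + σ ∈ Complex.slitPlane := by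
    left; simp; linarith
  have h0 : 1 + σ ≠ 0 := Complex.slitPlane_ne_zero hs
  unfold wth
  have h1 : DifferentiableAt ℂ (fun σ : ℂ => 1 + σ) σ := by fun_prop
  exact ((h1.clog hs).neg).add (((differentiableAt_id).div h1 h0).const_mul _)

lemma pl_bound {γ : ℝ} (hγ : 0 < γ) {G : ℂ → ℂ}
    (hd : DifferentiableOn ℂ G {w : ℂ | |w.im| < γ * π / 2})
    (hc : ContinuousOn G {w : ℂ | |w.im| ≤ γ * π / 2}) {K : ℝ}
    (hK : ∀ w : ℂ, |w.im| < γ * π / 2 → ‖G w‖ ≤ K)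
    (S : Finset ℕ) (c : ℕ → ℝ) (hcp : ∀ q, 0 < c q) {C : ℝ}
    (hb : ∀ w : ℂ, |w.im| = γ * π / 2 →
      ‖G w‖ ≤ C * Real.exp (∑ q ∈ S, γ * (wth (c q * Complex.exp (-w / γ))).re))
    (x : ℝ) :
    ‖G x‖ ≤ C * Real.exp (∑ q ∈ S, γ * (wth (c q * Complex.exp (-(x : ℂ) / γ))).re) := by
  set T : ℂ → ℂ := fun w => ∑ q ∈ S, (γ : ℂ) * wth (c q * Complex.exp (-w / γ)) with hT
  have hTre : ∀ w, (T w).re = ∑ q ∈ S, γ * (wth (c q * Complex.exp (-w / γ))).re := by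
    intro w
    simp only [hT, Complex.re_sum, Complex.re_ofReal_mul]
  have hTd : ∀ w : ℂ, |w.im| ≤ γ * π / 2 → DifferentiableAt ℂ T w := by
    intro w hw
    simp only [hT]
    apply DifferentiableAt.fun_sum
    intro q _
    apply DifferentiableAt.const_mul
    have h1 := wth_differentiableAt (exp_re_nonneg hγ hw (hcp q))
    have h2 : DifferentiableAt ℂ (fun w : ℂ => (c q : ℂ) * Complex.exp (-w / γ)) w := by fun_prop
    exact DifferentiableAt.comp w h1 h2
  have hset : Complex.im ⁻¹' Ioo (-(γ * π / 2)) (γ * π / 2) = {w : ℂ | |w.im| < γ * π / 2} := by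
    ext w; simp [abs_lt]
  have hpos : 0 < γ * π / 2 := by positivity
  have hclos : closure {w : ℂ | |w.im| < γ * π / 2} = {w : ℂ | |w.im| ≤ γ * π / 2} := by
    rw [← hset, Complex.closure_preimage_im, closure_Ioo (by linarith)]
    ext w; simp [abs_le]
  have hnorm : ∀ w, ‖G w * Complex.exp (-T w)‖ = ‖G w‖ * Real.exp (-(T w).re) := by
    intro w
    rw [norm_mul, Complex.norm_exp, Complex.neg_re]
  have hbd : ∀ w : ℂ, |w.im| = γ * π / 2 → ‖G w * Complex.exp (-T w)‖ ≤ C := by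
    intro w hw
    have := hb w hw
    rw [← hTre] at this
    rw [hnorm, Real.exp_neg, ← div_eq_mul_inv, div_le_iff₀ (Real.exp_pos _)]
    exact this
  have main : ‖G x * Complex.exp (-T x)‖ ≤ C := by
    apply PhragmenLindelof.horizontal_strip (a := -(γ * π / 2)) (b := γ * π / 2)
      (f := fun w => G w * Complex.exp (-T w))
    · rw [hset]
      refine ⟨?_, ?_⟩
      · exact hd.mul (fun w hw => ((hTd w (le_of_lt hw)).neg.cexp).differentiableWithinAt)
      · rw [hclos]
        exact hc.mul (fun w hw =>
          ((hTd w hw).neg.cexp).continuousAt.continuousWithinAt)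
    · refine ⟨1 / (2 * γ), ?_, ∑ q ∈ S, γ * (2 * (1 + Real.sqrt (c q))), ?_⟩
      · rw [show π / (γ * π / 2 - -(γ * π / 2)) = 1 / γ by field_simp; ring]
        apply one_div_lt_one_div_of_lt hγ; linarith
      · apply Asymptotics.IsBigO.of_bound K
        refine Filter.Eventually.filter_mono inf_le_right ?_
        rw [Filter.eventually_principal, hset]
        intro w hw
        rw [hnorm, Real.norm_of_nonneg (Real.exp_pos _).le]
        have hK0 : 0 ≤ K := (norm_nonneg _).trans (hK w hw)
        refine mul_le_mul (hK w hw) (Real.exp_le_exp.mpr ?_) (Real.exp_pos _).le hK0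
        rw [hTre, ← Finset.sum_neg_distrib, Finset.sum_mul]
        apply Finset.sum_le_sum
        intro q _
        have h1 := neg_wth_le (exp_re_nonneg hγ (le_of_lt hw) (hcp q))
        rw [exp_norm (hcp q), Real.sqrt_mul (hcp q).le] at h1
        have h2 : Real.sqrt (Real.exp (-w.re / γ)) ≤ Real.exp (1 / (2 * γ) * |w.re|) := by
          rw [← Real.exp_half]
          apply Real.exp_le_exp.mpr
          rw [show -w.re / γ / 2 = 1 / (2 * γ) * (-w.re) by field_simp]
          exact mul_le_mul_of_nonneg_left (neg_le_abs _) (by positivity)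
        have h3 : 1 ≤ Real.exp (1 / (2 * γ) * |w.re|) := Real.one_le_exp (by positivity)
        have h4 := mul_le_mul_of_nonneg_left h2 (Real.sqrt_nonneg (c q))
        have h5 : -(wth (c q * Complex.exp (-w / γ))).re ≤
          (2 * (1 + Real.sqrt (c q))) * Real.exp (1 / (2 * γ) * |w.re|) := by nlinarith
        nlinarith
    · intro w hw; apply hbd; rw [hw, abs_neg, abs_of_pos hpos]
    · intro w hw; apply hbd; rw [hw, abs_of_pos hpos]
    · simp; positivity
    · simp; positivity
  rw [hnorm, Real.exp_neg, ← div_eq_mul_inv, div_le_iff₀ (Real.exp_pos _), hTre] at main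
  exact main

/-! ### Sequences -/

lemma quot_mono {M : ℕ → ℝ} (hM : GoodSeq M) : Monotone (fun p : ℕ => M (p + 1) / M p) := by
  obtain ⟨-, hpos, hlc, -⟩ := hM
  apply monotone_nat_of_le_succ
  intro p
  rw [div_le_div_iff₀ (hpos _) (hpos _)]
  have := hlc p
  nlinarith

lemma quot_pos {M : ℕ → ℝ} (hM : GoodSeq M) (p : ℕ) : 0 < M (p + 1) / M p :=
  div_pos (hM.2.1 _) (hM.2.1 _)

lemma quot_prod {M : ℕ → ℝ} (hM : GoodSeq M) (p : ℕ) :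
    M p = ∏ q ∈ Finset.range p, (M (q + 1) / M q) := by
  induction p with
  | zero => simpa using hM.1
  | succ n ih =>
    rw [Finset.prod_range_succ, ← ih]
    have := (hM.2.1 n).ne'
    field_simp

lemma flat_min {t : ℕ → ℝ} (hmono : Monotone t) {b C : ℝ}
    (h : ∀ p, b ≤ C * ∏ q ∈ Finset.range p, t q) (N : ℕ) :
    b ≤ C * ∏ q ∈ Finset.range N, min 1 (t q) := by
  induction N with
  | zero => simpa using h 0
  | succ n ih =>
    by_cases hn : 1 ≤ t n
    · rw [Finset.prod_range_succ, min_eq_left hn, mul_one]; exact ih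
    · have : ∏ q ∈ Finset.range (n + 1), min 1 (t q) = ∏ q ∈ Finset.range (n + 1), t q := by
        apply Finset.prod_congr rfl
        intro q hq
        apply min_eq_right
        have : q ≤ n := by simpa [Nat.lt_succ_iff] using hq
        exact (hmono this).trans (le_of_lt (not_le.mp hn))
      rw [this]; exact h _

lemma flat_min_Ico {t : ℕ → ℝ} (hmono : Monotone t) (hpos : ∀ q, 0 < t q) {b C : ℝ} (hC : 0 < C)
    (h : ∀ p, b ≤ C * ∏ q ∈ Finset.range p, t q) {n N : ℕ} (hnN : n ≤ N) :
    b ≤ C * ∏ q ∈ Finset.Ico n N, min 1 (t q) := by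
  refine (flat_min hmono h N).trans ?_
  apply mul_le_mul_of_nonneg_left _ hC.le
  rw [← Finset.prod_range_mul_prod_Ico _ hnN]
  apply mul_le_of_le_one_left
  · exact Finset.prod_nonneg fun q _ => le_min zero_le_one (hpos q).le
  · exact Finset.prod_le_one (fun q _ => le_min zero_le_one (hpos q).le) fun q _ => min_le_left _ _

/-- The proximate order makes the liminf defining `ω(M)` a genuine one. -/
lemma cobdd {M : ℕ → ℝ} (hM : GoodSeq M) (hPO : AdmitsNonzeroProximateOrder M) :
    IsCoboundedUnder (· ≥ ·) atTop
      (fun p : ℕ => Real.log (M (p + 1) / M p) / Real.log (p : ℝ)) := by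
  obtain ⟨c, ℓ, ρ, hℓ, ⟨-, -, hlim, -⟩, A, B, hAB⟩ := hPO
  refine ⟨2 / ℓ, fun a ha => ?_⟩
  rw [Filter.eventually_map] at ha
  by_contra hcon
  have haℓ : 2 / ℓ < a := not_le.mp hcon
  have ha0 : 0 < a := lt_trans (by positivity) haℓ
  -- lower bound for the quotients
  have hlow : ∀ᶠ p : ℕ in atTop, (2 : ℝ) ^ (-a) * ((p : ℝ) + 1) ^ a ≤ M (p + 1) / M p := by
    filter_upwards [ha, eventually_ge_atTop 2] with p hp hp2
    have hp2' : (2 : ℝ) ≤ p := by exact_mod_cast hp2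
    have hlogp : 0 < Real.log p := Real.log_pos (by linarith)
    have hp' : a * Real.log p ≤ Real.log (M (p + 1) / M p) := (le_div_iff₀ hlogp).mp hp
    have h1 : (p : ℝ) ^ a ≤ M (p + 1) / M p := by
      rw [Real.rpow_def_of_pos (by linarith), ← Real.exp_log (quot_pos hM p)]
      apply Real.exp_le_exp.mpr; linarith
    refine le_trans ?_ h1
    have : (2 : ℝ) ^ (-a) * ((p : ℝ) + 1) ^ a = (((p : ℝ) + 1) / 2) ^ a := by
      rw [Real.div_rpow (by positivity) (by norm_num), Real.rpow_neg (by norm_num)]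
      field_simp
    rw [this]
    exact Real.rpow_le_rpow (by positivity) (by linarith) ha0.le
  obtain ⟨δ, hδ, hδm⟩ : ∃ δ : ℝ, 0 < δ ∧ ∀ p : ℕ, δ * ((p : ℝ) + 1) ^ a ≤ M (p + 1) / M p := by
    obtain ⟨n, hn⟩ := eventually_atTop.mp hlow
    have hm0 := quot_pos hM 0
    refine ⟨min (2 ^ (-a)) (M (0 + 1) / M 0 / ((n : ℝ) + 1) ^ a), by positivity, fun p => ?_⟩
    by_cases hpn : n ≤ p
    · exact (mul_le_mul_of_nonneg_right (min_le_left _ _) (by positivity)).trans (hn p hpn)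
    · refine (mul_le_mul_of_nonneg_right (min_le_right _ _) (by positivity)).trans ?_
      refine le_trans ?_ (quot_mono hM (Nat.zero_le p))
      have hpn' : (p : ℝ) ≤ n := by exact_mod_cast (not_le.mp hpn).le
      have : ((p : ℝ) + 1) ^ a ≤ ((n : ℝ) + 1) ^ a :=
        Real.rpow_le_rpow (by positivity) (by linarith) ha0.le
      rw [div_mul_eq_mul_div, div_le_iff₀ (by positivity)]
      exact mul_le_mul_of_nonneg_left this hm0.le
  have hMlow : ∀ p : ℕ, δ ^ p * ((p.factorial : ℝ)) ^ a ≤ M p := by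
    intro p
    rw [quot_prod hM p]
    induction p with
    | zero => simp
    | succ n ih =>
      rw [Finset.prod_range_succ, Nat.factorial_succ]
      push_cast
      rw [Real.mul_rpow (by positivity) (by positivity), pow_succ]
      calc _ = (δ ^ n * (n.factorial : ℝ) ^ a) * (δ * ((n : ℝ) + 1) ^ a) := by ring
        _ ≤ _ := by
          refine mul_le_mul ih (hδm n) (by positivity) ?_
          exact Finset.prod_nonneg fun q _ => (quot_pos hM q).le
  have hassoc : ∀ t : ℝ, 0 < t → assocM M t ≤ a * (t / δ) ^ (1 / a) := by
    intro t ht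
    apply ciSup_le
    intro p
    set τ := (t / δ) ^ (1 / a) with hτ
    have hτ0 : 0 < τ := by positivity
    have hτa : τ ^ a = t / δ := by
      rw [hτ, ← Real.rpow_mul (by positivity), one_div_mul_cancel ha0.ne', Real.rpow_one]
    have h1 : τ ^ p / p.factorial ≤ Real.exp τ := Real.pow_div_factorial_le_exp τ hτ0.le p
    have h2 : t ^ p / M p ≤ (τ ^ p / p.factorial) ^ a := by
      rw [Real.div_rpow (by positivity) (by positivity), ← Real.rpow_natCast τ p,
        ← Real.rpow_mul hτ0.le, mul_comm (p : ℝ) a, Real.rpow_mul hτ0.le, hτa, Real.rpow_natCast,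
        div_pow, div_div]
      exact div_le_div_of_nonneg_left (by positivity) (by positivity) (hMlow p)
    have h3 : t ^ p / M p ≤ Real.exp (a * τ) := by
      refine h2.trans ?_
      rw [mul_comm a τ, Real.exp_mul]
      exact Real.rpow_le_rpow (by positivity) h1 ha0.le
    have hMp := hM.2.1 p
    rw [← Real.log_exp (a * τ)]
    exact Real.log_le_log (by positivity) h3
  have hassoc0 : ∀ t : ℝ, 0 ≤ assocM M t := by
    intro t
    apply Real.iSup_nonneg'
    exact ⟨0, by simp [hM.1]⟩
  have hε : 0 < ℓ / 2 - 1 / a := by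
    have : 1 / a < ℓ / 2 := by
      rw [div_lt_iff₀ hℓ] at haℓ
      rw [div_lt_div_iff₀ ha0 (by norm_num)]; linarith
    linarith
  have hbig : Tendsto (fun t => (ℓ / 2 - 1 / a) * Real.log t) atTop atTop :=
    Real.tendsto_log_atTop.const_mul_atTop hε
  have hbig2 : Tendsto (fun t => (ℓ / 2) * Real.log t) atTop atTop :=
    Real.tendsto_log_atTop.const_mul_atTop (by positivity)
  have hev := ((hAB.and (hlim.eventually (lt_mem_nhds (show ℓ / 2 < ℓ by linarith)))).and
    ((hbig.eventually_gt_atTop (B + Real.log a - 1 / a * Real.log δ)).and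
      (hbig2.eventually_gt_atTop B))).and (eventually_gt_atTop 1)
  obtain ⟨t, ⟨⟨⟨-, h1⟩, h2⟩, h3, h4⟩, h5⟩ := hev.exists
  have hlogt : 0 < Real.log t := Real.log_pos h5
  have h6 : Real.log t * (ρ t - Real.log (assocM M t) / Real.log t)
      = ρ t * Real.log t - Real.log (assocM M t) := by field_simp
  rw [h6] at h1
  have h7 : ℓ / 2 * Real.log t ≤ ρ t * Real.log t := mul_le_mul_of_nonneg_right h2.le hlogt.le
  have ht0 : 0 < t := by linarith
  rcases (hassoc0 t).eq_or_lt with h0 | h0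
  · rw [← h0, Real.log_zero] at h1
    linarith
  · have h8 := Real.log_le_log h0 (hassoc t ht0)
    rw [Real.log_mul ha0.ne' (by positivity), Real.log_rpow (by positivity),
      Real.log_div ht0.ne' hδ.ne'] at h8
    nlinarith

lemma diverges {M : ℕ → ℝ} (hM : GoodSeq M) (hPO : AdmitsNonzeroProximateOrder M)
    {γ : ℝ} (hγ0 : 0 < γ)
    (hcond : omegaM M < γ ∨ (γ = omegaM M ∧
      ¬ Summable (fun p : ℕ => (M (p + 1) / M p) ^ (-(1 / omegaM M))))) :
    ¬ Summable (fun p : ℕ => (M (p + 1) / M p) ^ (-(1 / γ))) := by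
  rcases hcond with h | ⟨h, h'⟩
  swap
  · rw [h]; exact h'
  intro hs
  have hnn : ∀ p : ℕ, 0 < (M (p + 1) / M p) ^ (-(1 / γ)) := fun p =>
    Real.rpow_pos_of_pos (quot_pos hM p) _
  set S := ∑' p : ℕ, (M (p + 1) / M p) ^ (-(1 / γ)) with hS
  have hS0 : 0 < S := hs.tsum_pos (fun p => (hnn p).le) 0 (hnn 0)
  have hle : ∀ n : ℕ, (n : ℝ) * (M (n + 1) / M n) ^ (-(1 / γ)) ≤ S := by
    intro n
    refine le_trans ?_ (hs.sum_le_tsum (Finset.range n) (fun p _ => (hnn p).le))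
    have := Finset.card_nsmul_le_sum (Finset.range n)
      (fun p : ℕ => (M (p + 1) / M p) ^ (-(1 / γ))) ((M (n + 1) / M n) ^ (-(1 / γ))) (by
        intro q hq
        apply Real.rpow_le_rpow_of_nonpos (quot_pos hM q)
        · exact quot_mono hM (Finset.mem_range.mp hq).le
        · simp; positivity)
    simpa using this
  obtain ⟨γ', hγ1, hγ2⟩ := exists_between h
  have hlogn : Tendsto (fun n : ℕ => (γ - γ') * Real.log (n : ℝ)) atTop atTop :=
    (Real.tendsto_log_atTop.comp tendsto_natCast_atTop_atTop).const_mul_atTop (by linarith)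
  have hge : γ' ≤ omegaM M := by
    apply le_liminf_of_le (cobdd hM hPO)
    filter_upwards [hlogn.eventually_ge_atTop (γ * Real.log S), eventually_ge_atTop 2]
      with n hn hn2
    have hn2' : (2 : ℝ) ≤ n := by exact_mod_cast hn2
    have hlogp : 0 < Real.log n := Real.log_pos (by linarith)
    rw [le_div_iff₀ hlogp]
    have h1 := Real.log_le_log (mul_pos (by linarith) (hnn n)) (hle n)
    rw [Real.log_mul (by linarith) (hnn n).ne', Real.log_rpow (quot_pos hM n)] at h1
    have h2 := mul_le_mul_of_nonneg_left h1 hγ0.le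
    have h3 : γ * (Real.log n + -(1 / γ) * Real.log (M (n + 1) / M n))
        = γ * Real.log n - Real.log (M (n + 1) / M n) := by field_simp; ring
    linarith
  linarith

/-- Vanishing on the real line. -/
lemma zero_on_real {M : ℕ → ℝ} (hM : GoodSeq M) {γ : ℝ} (hγ0 : 0 < γ)
    (hdiv : ¬ Summable (fun p : ℕ => (M (p + 1) / M p) ^ (-(1 / γ))))
    {g : ℂ → ℂ}
    (hd : DifferentiableOn ℂ g {w : ℂ | |w.im| < γ * π / 2})
    (hc : ContinuousOn g {w : ℂ | |w.im| ≤ γ * π / 2}) {K : ℝ} (hK0 : 0 < K)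
    (hK : ∀ w : ℂ, |w.im| ≤ γ * π / 2 → ‖g w‖ ≤ K)
    (hflat : MFlatDir M g {w : ℂ | |w.im| ≤ γ * π / 2} (γ * π / 2)) (x : ℝ) :
    g x = 0 := by
  obtain ⟨r, C, A, hr, hC, hA, -, hfl⟩ := hflat
  set m : ℕ → ℝ := fun p => M (p + 1) / M p with hm
  have hmpos : ∀ p, 0 < m p := quot_pos hM
  have hmmono : Monotone m := quot_mono hM
  have hmtop : Tendsto m atTop atTop := hM.2.2.2
  set c : ℕ → ℝ := fun q => (A * m q) ^ (-(1 / γ)) / 2 with hcdef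
  have hcpos : ∀ q, 0 < c q := fun q =>
    div_pos (Real.rpow_pos_of_pos (mul_pos hA (hmpos q)) _) (by norm_num)
  set G : ℂ → ℂ := fun w => g w * (starRingEnd ℂ) (g ((starRingEnd ℂ) w)) with hG
  have hopen : IsOpen {w : ℂ | |w.im| < γ * π / 2} :=
    isOpen_lt (by fun_prop) continuous_const
  have hGd : DifferentiableOn ℂ G {w : ℂ | |w.im| < γ * π / 2} := by
    refine hd.mul ?_
    intro w hw
    have hw' : (starRingEnd ℂ) w ∈ {w : ℂ | |w.im| < γ * π / 2} := by
      simpa using hw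
    have h1 : DifferentiableAt ℂ g ((starRingEnd ℂ) w) := hd.differentiableAt (hopen.mem_nhds hw')
    have h2 := h1.conj_conj
    rw [Complex.conj_conj] at h2
    exact h2.differentiableWithinAt
  have hGc : ContinuousOn G {w : ℂ | |w.im| ≤ γ * π / 2} := by
    refine hc.mul ?_
    refine Complex.continuous_conj.comp_continuousOn (hc.comp Complex.continuous_conj.continuousOn ?_)
    intro w hw
    simpa using hw
  have hGn : ∀ w, ‖G w‖ = ‖g w‖ * ‖g ((starRingEnd ℂ) w)‖ := by
    intro w; simp [hG]
  have hGK : ∀ w : ℂ, |w.im| < γ * π / 2 → ‖G w‖ ≤ K * K := by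
    intro w hw
    rw [hGn]
    exact mul_le_mul (hK w hw.le) (hK _ (by simpa using hw.le)) (norm_nonneg _) hK0.le
  -- choice of the starting index
  have hev : ∀ᶠ q in atTop, Real.exp (-x) / A ≤ m q ∧ 1 / (A * r) ≤ m q :=
    (hmtop.eventually_ge_atTop _).and (hmtop.eventually_ge_atTop _)
  obtain ⟨n, hn⟩ := eventually_atTop.mp hev
  -- the flatness on the upper boundary
  have hup : ∀ N, n ≤ N → ∀ w : ℂ, w.im = γ * π / 2 → ‖g w‖ ≤ (C + K) *
      Real.exp (∑ q ∈ Finset.Ico n N, γ * (wth (c q * Complex.exp (-w / γ))).re) := by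
    intro N hN w hw
    have hpos : 0 < γ * π / 2 := by positivity
    have hwabs : |w.im| = γ * π / 2 := by rw [hw, abs_of_pos hpos]
    set t : ℕ → ℝ := fun q => A * m q * Real.exp w.re with ht
    have htpos : ∀ q, 0 < t q := fun q => mul_pos (mul_pos hA (hmpos q)) (Real.exp_pos _)
    have htmono : Monotone t := fun p q hpq => by
      apply mul_le_mul_of_nonneg_right _ (Real.exp_pos _).le
      exact mul_le_mul_of_nonneg_left (hmmono hpq) hA.le
    have key : ∏ q ∈ Finset.Ico n N, min 1 (t q) ≤
        Real.exp (∑ q ∈ Finset.Ico n N, γ * (wth (c q * Complex.exp (-w / γ))).re) := by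
      rw [Real.exp_sum]
      apply Finset.prod_le_prod
      · intro q _; exact le_min zero_le_one (htpos q).le
      · intro q _
        apply wth_min_le hγ0 (exp_re_zero hγ0 hwabs)
        · rw [exp_norm (hcpos q)]; exact mul_pos (hcpos q) (Real.exp_pos _)
        · rw [exp_norm (hcpos q)]
          have hAm : 0 < A * m q := mul_pos hA (hmpos q)
          rw [show 2 * (c q * Real.exp (-w.re / γ))
            = (A * m q) ^ (-(1 / γ)) * Real.exp (-w.re / γ) by simp only [hcdef]; ring]
          rw [Real.mul_rpow (by positivity) (by positivity), ← Real.rpow_mul hAm.le,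
            ← Real.exp_mul]
          rw [show -(1 / γ) * -γ = 1 by field_simp, show -w.re / γ * -γ = w.re by field_simp,
            Real.rpow_one]
    have hP0 : 0 ≤ ∏ q ∈ Finset.Ico n N, min 1 (t q) :=
      Finset.prod_nonneg fun q _ => le_min zero_le_one (htpos q).le
    refine le_trans ?_ (mul_le_mul_of_nonneg_left key (by positivity))
    by_cases hx : w.re ≤ Real.log r
    · have hwe : w = ⟨w.re, γ * π / 2⟩ := by rw [← hw]
      have h1 : ∀ p, ‖g w‖ ≤ C * ∏ q ∈ Finset.range p, t q := by
        intro p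
        have := hfl w.re hx p
        rw [← hwe] at this
        refine this.trans (le_of_eq ?_)
        rw [ht, Finset.prod_mul_distrib, Finset.prod_mul_distrib, ← quot_prod hM p]
        simp; ring
      refine (flat_min_Ico htmono htpos hC h1 hN).trans ?_
      exact mul_le_mul_of_nonneg_right (by linarith) hP0
    · have h1 : ∏ q ∈ Finset.Ico n N, min 1 (t q) = 1 := by
        apply Finset.prod_eq_one
        intro q hq
        apply min_eq_left
        have h2 := (hn q (Finset.mem_Ico.mp hq).1).2
        have h3 : r ≤ Real.exp w.re := by
          rw [← Real.exp_log hr]; exact Real.exp_le_exp.mpr (not_le.mp hx).le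
        rw [div_le_iff₀ (by positivity)] at h2
        have h4 : 0 ≤ A * m q := (mul_pos hA (hmpos q)).le
        calc (1 : ℝ) ≤ A * m q * r := by linarith
          _ ≤ A * m q * Real.exp w.re := mul_le_mul_of_nonneg_left h3 h4
      rw [h1, mul_one]
      exact (hK w hwabs.le).trans (by linarith)
  have hreconj : ∀ (w : ℂ) (q : ℕ), (wth (c q * Complex.exp (-((starRingEnd ℂ) w) / γ))).re
      = (wth (c q * Complex.exp (-w / γ))).re := by
    intro w q
    have h1 : (c q : ℂ) * Complex.exp (-((starRingEnd ℂ) w) / γ)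
        = (starRingEnd ℂ) (c q * Complex.exp (-w / γ)) := by
      rw [map_mul, ← Complex.exp_conj, map_div₀, map_neg, Complex.conj_ofReal, Complex.conj_ofReal]
    rw [h1, wth_re, wth_re, div_re_formula, div_re_formula]
    have h2 : ∀ σ : ℂ, ‖1 + (starRingEnd ℂ) σ‖ = ‖1 + σ‖ := by
      intro σ
      rw [← Complex.norm_conj (1 + σ), map_add, map_one]
    rw [h2]
    simp only [Complex.conj_re, Complex.conj_im, neg_sq]
  have hbound : ∀ N, n ≤ N → ‖g x‖ ^ 2 ≤ (C + K) * K * Real.exp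
      (-(∑ q ∈ Finset.Ico n N, γ * (c q * Real.exp (-x / γ) / 8))) := by
    intro N hN
    have h1 := pl_bound hγ0 hGd hGc hGK (Finset.Ico n N) c hcpos (C := (C + K) * K) (by
      intro w hw
      rw [hGn]
      rcases abs_eq (show 0 ≤ γ * π / 2 by positivity) |>.mp hw with h | h
      · have h1 := hup N hN w h
        have h2 := hK ((starRingEnd ℂ) w) (by simpa using hw.le)
        calc _ ≤ _ := mul_le_mul h1 h2 (norm_nonneg _) (by positivity)
          _ = _ := by ring
      · have h1 := hup N hN ((starRingEnd ℂ) w) (by simp [h])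
        have h2 := hK w hw.le
        simp only [hreconj] at h1
        calc _ ≤ _ := mul_le_mul h2 h1 (norm_nonneg _) (by positivity)
          _ = _ := by ring) x
    rw [hGn, Complex.conj_ofReal, ← sq] at h1
    refine h1.trans ?_
    apply mul_le_mul_of_nonneg_left _ (by positivity)
    apply Real.exp_le_exp.mpr
    rw [← Finset.sum_neg_distrib]
    apply Finset.sum_le_sum
    intro q hq
    rw [← mul_neg]
    apply mul_le_mul_of_nonneg_left _ hγ0.le
    have e : (c q : ℂ) * Complex.exp (-(x : ℂ) / γ) = ((c q * Real.exp (-x / γ) : ℝ) : ℂ) := by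
      push_cast; rfl
    rw [e]
    apply wth_real (mul_pos (hcpos q) (Real.exp_pos _))
    have h2 := (hn q (Finset.mem_Ico.mp hq).1).1
    rw [div_le_iff₀ hA] at h2
    have hAm : 0 < A * m q := mul_pos hA (hmpos q)
    have h3 : Real.exp (-x / γ) ≤ (A * m q) ^ (1 / γ) := by
      rw [div_eq_mul_one_div (-x) γ, Real.exp_mul]
      exact Real.rpow_le_rpow (Real.exp_pos _).le (by linarith) (by positivity)
    have h4 : c q * (A * m q) ^ (1 / γ) = 1 / 2 := by
      simp only [hcdef]
      rw [Real.rpow_neg hAm.le]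
      have : 0 < (A * m q) ^ (1 / γ) := by positivity
      field_simp
    have := mul_le_mul_of_nonneg_left h3 (hcpos q).le
    linarith
  -- divergence
  have hdiv2 : ¬ Summable (fun q => γ * (c q * Real.exp (-x / γ) / 8)) := by
    intro hs
    apply hdiv
    have hA0 : 0 < A ^ (-(1 / γ)) := Real.rpow_pos_of_pos hA _
    have := hs.mul_left (16 / (γ * A ^ (-(1 / γ)) * Real.exp (-x / γ)))
    refine this.congr ?_
    intro q
    simp only [hcdef]
    rw [Real.mul_rpow hA.le (hmpos q).le]
    have := Real.exp_pos (-x / γ)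
    field_simp
    norm_num [hm]
  have hnnt : ∀ q, 0 ≤ γ * (c q * Real.exp (-x / γ) / 8) := fun q => by
    have := hcpos q
    positivity
  have htend := (not_summable_iff_tendsto_nat_atTop_of_nonneg hnnt).mp hdiv2
  have htend2 : Tendsto (fun N => ∑ q ∈ Finset.Ico n N, γ * (c q * Real.exp (-x / γ) / 8))
      atTop atTop := by
    have h1 := tendsto_atTop_add_const_right atTop
      (-(∑ q ∈ Finset.range n, γ * (c q * Real.exp (-x / γ) / 8))) htend
    refine h1.congr' ?_
    filter_upwards [eventually_ge_atTop n] with N hN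
    rw [Finset.sum_Ico_eq_sub _ hN]; ring
  have hlim : Tendsto (fun N => (C + K) * K * Real.exp
      (-(∑ q ∈ Finset.Ico n N, γ * (c q * Real.exp (-x / γ) / 8)))) atTop (𝓝 0) := by
    have := (Real.tendsto_exp_neg_atTop_nhds_zero.comp htend2).const_mul ((C + K) * K)
    simpa using this
  have hfin : ‖g x‖ ^ 2 ≤ 0 := by
    apply ge_of_tendsto hlim
    filter_upwards [eventually_ge_atTop n] with N hN using hbound N hN
  have : ‖g x‖ = 0 := by
    have := le_antisymm hfin (sq_nonneg _)
    exact pow_eq_zero_iff (two_ne_zero) |>.mp this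
  exact norm_eq_zero.mp this

/-- Lemma 4.3 of the paper, Watson's lemma, one boundary direction:
suppose `γ > ω(M)`, or `γ = ω(M)` and `Σ (m_p)^{−1/ω(M)}` diverges.  If the bounded
holomorphic `f` on `S_γ`, with continuous extension `g` to the closed sector, is `M`-flat
in the single boundary direction `πγ/2`, then `f ≡ 0`. -/
theorem watson_one_direction
    (M : ℕ → ℝ) (hM : GoodSeq M) (hPO : AdmitsNonzeroProximateOrder M)
    (γ : ℝ) (hγ0 : 0 < γ)
    (hcond : omegaM M < γ ∨ (γ = omegaM M ∧
      ¬ Summable (fun p : ℕ => (M (p + 1) / M p) ^ (-(1 / omegaM M)))))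
    (f g : ℂ → ℂ)
    (hf : DifferentiableOn ℂ f (logSector 0 γ))
    (hbd : ∃ K : ℝ, ∀ w ∈ logSector 0 γ, ‖f w‖ ≤ K)
    (hg : ContinuousOn g {w : ℂ | |w.im| ≤ γ * π / 2})
    (hfg : ∀ w ∈ logSector 0 γ, g w = f w)
    (hflat : MFlatDir M g {w : ℂ | |w.im| ≤ γ * π / 2} (γ * π / 2)) :
    ∀ w ∈ logSector 0 γ, f w = 0 := by
  have hpos : 0 < γ * π / 2 := by positivity
  have hsec : logSector 0 γ = {w : ℂ | |w.im| < γ * π / 2} := by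
    ext w; simp [logSector]
  rw [hsec] at hf hbd hfg ⊢
  have hset : Complex.im ⁻¹' Ioo (-(γ * π / 2)) (γ * π / 2) = {w : ℂ | |w.im| < γ * π / 2} := by
    ext w; simp [abs_lt]
  have hclos : closure {w : ℂ | |w.im| < γ * π / 2} = {w : ℂ | |w.im| ≤ γ * π / 2} := by
    rw [← hset, Complex.closure_preimage_im, closure_Ioo (by linarith)]
    ext w; simp [abs_le]
  have hopen : IsOpen {w : ℂ | |w.im| < γ * π / 2} :=
    isOpen_lt (by fun_prop) continuous_const
  obtain ⟨K, hK⟩ := hbd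
  have hgd : DifferentiableOn ℂ g {w : ℂ | |w.im| < γ * π / 2} := hf.congr hfg
  have hgK : ∀ w : ℂ, |w.im| ≤ γ * π / 2 → ‖g w‖ ≤ |K| + 1 := by
    intro w hw
    have hw' : w ∈ closure {w : ℂ | |w.im| < γ * π / 2} := by rw [hclos]; exact hw
    have hcw : ContinuousWithinAt g {w : ℂ | |w.im| < γ * π / 2} w :=
      (hg w hw).mono (fun v hv => show |v.im| ≤ _ from le_of_lt hv)
    have : g w ∈ closure (Metric.closedBall (0 : ℂ) (|K| + 1)) := by
      refine hcw.mem_closure hw' (fun v hv => ?_)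
      rw [mem_closedBall_zero_iff, hfg v hv]
      have h1 := hK v hv
      have h2 := le_abs_self K
      linarith
    rw [Metric.isClosed_closedBall.closure_eq, mem_closedBall_zero_iff] at this
    exact this
  have hzero : ∀ x : ℝ, g x = 0 := fun x =>
    zero_on_real hM hγ0 (diverges hM hPO hγ0 hcond) hgd hg (by positivity) hgK hflat x
  have hfzero : ∀ x : ℝ, f x = 0 := fun x => by
    rw [← hfg (x : ℂ) (by simpa using hpos)]; exact hzero x
  have han : AnalyticOnNhd ℂ f {w : ℂ | |w.im| < γ * π / 2} := hf.analyticOnNhd hopen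
  have hpre : IsPreconnected {w : ℂ | |w.im| < γ * π / 2} := by
    rw [← hset]
    exact ((convex_Ioo _ _).is_linear_preimage Complex.imLm.isLinear).isPreconnected
  have hfreq : ∃ᶠ z in 𝓝[≠] (0 : ℂ), f z = 0 := by
    have ht : Tendsto (fun x : ℝ => (x : ℂ)) (𝓝[≠] (0 : ℝ)) (𝓝[≠] (0 : ℂ)) := by
      apply tendsto_nhdsWithin_of_tendsto_nhds_of_eventually_within
      · have : Tendsto (fun x : ℝ => (x : ℂ)) (𝓝 0) (𝓝 ((0 : ℝ) : ℂ)) :=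
          Complex.continuous_ofReal.tendsto 0
        rw [Complex.ofReal_zero] at this
        exact this.mono_left nhdsWithin_le_nhds
      · filter_upwards [self_mem_nhdsWithin] with x hx
        simpa using hx
    exact ht.frequently (Filter.Eventually.frequently (Filter.Eventually.of_forall hfzero))
  intro w hw
  exact han.eqOn_zero_of_preconnected_of_frequently_eq_zero hpre
    (show (0 : ℂ) ∈ {w : ℂ | |w.im| < γ * π / 2} by simpa using hpos) hfreq hw
end
end
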